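/- arXiv:1306.4829 — 2 statements merged into one kernel-verified Lean document; each statement's English description precedes it below -/
import Mathlib

section
/- Let A be a right weak bimonoid in a duoidal category (M,∘,I,•,J) in which idempotent morphisms split. Then the composite π^R_∘.(τ∘A) : A → R_∘ is a morphism of comonoids in (M,•) from (A,Δ,ε) to (R_∘,Δ^R_∘,ε^R_∘); that is, Δ^R_∘.π^R_∘.(τ∘A) = ((π^R_∘.(τ∘A))•(π^R_∘.(τ∘A))).Δ and ε^R_∘.π^R_∘.(τ∘A) = ε. -/
open CategoryTheory

universe v u

/-- A (strict) duoidal category structure on a category `M`: two strict monoidal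
structures `co` (the first monoidal product `∘` with unit `uI`) and `bu` (the second
monoidal product `•` with unit `uJ`), together with the structure morphisms
`dlI : I ⟶ I • I`, `pw : J ∘ J ⟶ J`, `tau : I ⟶ J` and the interchange law `zt`,
subject to the axioms of a duoidal category. -/
structure Duo (M : Type u) [Category.{v} M] where
  co : M → M → M
  coh : ∀ {X₁ Y₁ X₂ Y₂ : M}, (X₁ ⟶ Y₁) → (X₂ ⟶ Y₂) → (co X₁ X₂ ⟶ co Y₁ Y₂)
  uI : M
  bu : M → M → M
  buh : ∀ {X₁ Y₁ X₂ Y₂ : M}, (X₁ ⟶ Y₁) → (X₂ ⟶ Y₂) → (bu X₁ X₂ ⟶ bu Y₁ Y₂)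
  uJ : M
  coA : ∀ X Y Z, co (co X Y) Z = co X (co Y Z)
  coL : ∀ X, co uI X = X
  coR : ∀ X, co X uI = X
  buA : ∀ X Y Z, bu (bu X Y) Z = bu X (bu Y Z)
  buL : ∀ X, bu uJ X = X
  buR : ∀ X, bu X uJ = X
  coh_id : ∀ X Y, coh (𝟙 X) (𝟙 Y) = 𝟙 (co X Y)
  coh_comp : ∀ {X₁ Y₁ Z₁ X₂ Y₂ Z₂ : M} (f₁ : X₁ ⟶ Y₁) (g₁ : Y₁ ⟶ Z₁) (f₂ : X₂ ⟶ Y₂)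
    (g₂ : Y₂ ⟶ Z₂), coh (f₁ ≫ g₁) (f₂ ≫ g₂) = coh f₁ f₂ ≫ coh g₁ g₂
  buh_id : ∀ X Y, buh (𝟙 X) (𝟙 Y) = 𝟙 (bu X Y)
  buh_comp : ∀ {X₁ Y₁ Z₁ X₂ Y₂ Z₂ : M} (f₁ : X₁ ⟶ Y₁) (g₁ : Y₁ ⟶ Z₁) (f₂ : X₂ ⟶ Y₂)
    (g₂ : Y₂ ⟶ Z₂), buh (f₁ ≫ g₁) (f₂ ≫ g₂) = buh f₁ f₂ ≫ buh g₁ g₂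
  coh_assoc : ∀ {X₁ Y₁ X₂ Y₂ X₃ Y₃ : M} (f₁ : X₁ ⟶ Y₁) (f₂ : X₂ ⟶ Y₂) (f₃ : X₃ ⟶ Y₃),
    coh (coh f₁ f₂) f₃
      = eqToHom (coA X₁ X₂ X₃) ≫ coh f₁ (coh f₂ f₃) ≫ eqToHom (coA Y₁ Y₂ Y₃).symm
  coh_unitL : ∀ {X Y : M} (f : X ⟶ Y),
    coh (𝟙 uI) f = eqToHom (coL X) ≫ f ≫ eqToHom (coL Y).symm
  coh_unitR : ∀ {X Y : M} (f : X ⟶ Y),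
    coh f (𝟙 uI) = eqToHom (coR X) ≫ f ≫ eqToHom (coR Y).symm
  buh_assoc : ∀ {X₁ Y₁ X₂ Y₂ X₃ Y₃ : M} (f₁ : X₁ ⟶ Y₁) (f₂ : X₂ ⟶ Y₂) (f₃ : X₃ ⟶ Y₃),
    buh (buh f₁ f₂) f₃
      = eqToHom (buA X₁ X₂ X₃) ≫ buh f₁ (buh f₂ f₃) ≫ eqToHom (buA Y₁ Y₂ Y₃).symm
  buh_unitL : ∀ {X Y : M} (f : X ⟶ Y),
    buh (𝟙 uJ) f = eqToHom (buL X) ≫ f ≫ eqToHom (buL Y).symm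
  buh_unitR : ∀ {X Y : M} (f : X ⟶ Y),
    buh f (𝟙 uJ) = eqToHom (buR X) ≫ f ≫ eqToHom (buR Y).symm
  dlI : uI ⟶ bu uI uI
  pw : co uJ uJ ⟶ uJ
  tau : uI ⟶ uJ
  zt : ∀ A B C D : M, co (bu A B) (bu C D) ⟶ bu (co A C) (co B D)
  zt_nat : ∀ {A A' B B' C C' D D' : M} (f : A ⟶ A') (g : B ⟶ B') (h : C ⟶ C')
    (k : D ⟶ D'),
    coh (buh f g) (buh h k) ≫ zt A' B' C' D' = zt A B C D ≫ buh (coh f h) (coh g k)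
  pw_assoc : coh pw (𝟙 uJ) ≫ pw = eqToHom (coA uJ uJ uJ) ≫ coh (𝟙 uJ) pw ≫ pw
  pw_unitL : eqToHom (coL uJ).symm ≫ coh tau (𝟙 uJ) ≫ pw = 𝟙 uJ
  pw_unitR : eqToHom (coR uJ).symm ≫ coh (𝟙 uJ) tau ≫ pw = 𝟙 uJ
  dlI_coassoc : dlI ≫ buh dlI (𝟙 uI) ≫ eqToHom (buA uI uI uI) = dlI ≫ buh (𝟙 uI) dlI
  dlI_counitL : dlI ≫ buh tau (𝟙 uI) ≫ eqToHom (buL uI) = 𝟙 uI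
  dlI_counitR : dlI ≫ buh (𝟙 uI) tau ≫ eqToHom (buR uI) = 𝟙 uI
  zt_assoc1 : ∀ A B C D E F : M,
    coh (zt A B C D) (𝟙 (bu E F)) ≫ zt (co A C) (co B D) E F
      = eqToHom (coA (bu A B) (bu C D) (bu E F)) ≫ coh (𝟙 (bu A B)) (zt C D E F)
          ≫ zt A B (co C E) (co D F)
          ≫ eqToHom (show bu (co A (co C E)) (co B (co D F))
              = bu (co (co A C) E) (co (co B D) F) by simp [coA])
  zt_assoc2 : ∀ A B C D E F : M,
    zt (bu A B) C (bu D E) F ≫ buh (zt A B D E) (𝟙 (co C F))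
      = eqToHom (show co (bu (bu A B) C) (bu (bu D E) F)
            = co (bu A (bu B C)) (bu D (bu E F)) by simp [buA])
          ≫ zt A (bu B C) D (bu E F) ≫ buh (𝟙 (co A D)) (zt B C E F)
          ≫ eqToHom (buA (co A D) (co B E) (co C F)).symm
  zt_unitA : ∀ A B : M,
    eqToHom (coL (bu A B)).symm ≫ coh dlI (𝟙 (bu A B)) ≫ zt uI uI A B
      ≫ eqToHom (show bu (co uI A) (co uI B) = bu A B by simp [coL]) = 𝟙 (bu A B)
  zt_unitB : ∀ A B : M,
    eqToHom (coR (bu A B)).symm ≫ coh (𝟙 (bu A B)) dlI ≫ zt A B uI uI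
      ≫ eqToHom (show bu (co A uI) (co B uI) = bu A B by simp [coR]) = 𝟙 (bu A B)
  zt_unitC : ∀ A B : M,
    eqToHom (show co A B = co (bu uJ A) (bu uJ B) by simp [buL]) ≫ zt uJ A uJ B
      ≫ buh pw (𝟙 (co A B)) ≫ eqToHom (buL (co A B)) = 𝟙 (co A B)
  zt_unitD : ∀ A B : M,
    eqToHom (show co A B = co (bu A uJ) (bu B uJ) by simp [buR]) ≫ zt A uJ B uJ
      ≫ buh (𝟙 (co A B)) pw ≫ eqToHom (buR (co A B)) = 𝟙 (co A B)

namespace Duo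

variable {M : Type u} [Category.{v} M] (D : Duo M)

/-- Axiom (WB): the multiplication is comultiplicative. -/
def WBeq (A : M) (mu : D.co A A ⟶ A) (dl : A ⟶ D.bu A A) : Prop :=
  mu ≫ dl = D.coh dl dl ≫ D.zt A A A A ≫ D.buh mu mu

/-- Axiom (RRU). -/
def RRUeq (A : M) (mu : D.co A A ⟶ A) (eta : D.uI ⟶ A) (dl : A ⟶ D.bu A A) : Prop :=
  D.dlI ≫ D.buh (𝟙 D.uI) (eta ≫ dl)
    ≫ eqToHom (show D.bu D.uI (D.bu A A) = D.bu (D.co (D.bu D.uI A) D.uI) A by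
        simp [D.coR, D.buA])
    ≫ D.buh (D.coh (𝟙 (D.bu D.uI A)) D.dlI) (𝟙 A)
    ≫ D.buh (D.coh (𝟙 (D.bu D.uI A)) (D.buh (𝟙 D.uI) (eta ≫ dl))) (𝟙 A)
    ≫ eqToHom (show D.bu (D.co (D.bu D.uI A) (D.bu D.uI (D.bu A A))) A
        = D.bu (D.co (D.bu D.uI A) (D.bu (D.bu D.uI A) A)) A by simp [D.buA])
    ≫ D.buh (D.zt D.uI A (D.bu D.uI A) A) (𝟙 A)
    ≫ eqToHom (show D.bu (D.bu (D.co D.uI (D.bu D.uI A)) (D.co A A)) A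
        = D.bu (D.bu (D.bu D.uI A) (D.co A A)) A by simp [D.coL])
    ≫ D.buh (D.buh (𝟙 (D.bu D.uI A)) mu) (𝟙 A)
  = D.dlI ≫ D.buh (𝟙 D.uI) eta ≫ D.buh (𝟙 D.uI) dl
    ≫ eqToHom (show D.bu D.uI (D.bu A A) = D.bu (D.bu D.uI A) A by simp [D.buA])
    ≫ D.buh (𝟙 (D.bu D.uI A)) dl
    ≫ eqToHom (show D.bu (D.bu D.uI A) (D.bu A A)
        = D.bu (D.bu (D.bu D.uI A) A) A by simp [D.buA])

/-- Axiom (LRU). -/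
def LRUeq (A : M) (mu : D.co A A ⟶ A) (eta : D.uI ⟶ A) (dl : A ⟶ D.bu A A) : Prop :=
  D.dlI ≫ D.buh (eta ≫ dl) (𝟙 D.uI)
    ≫ eqToHom (show D.bu (D.bu A A) D.uI = D.bu A (D.co (D.bu A D.uI) D.uI) by
        simp [D.coR, D.buA])
    ≫ D.buh (𝟙 A) (D.coh (𝟙 (D.bu A D.uI)) D.dlI)
    ≫ D.buh (𝟙 A) (D.coh (𝟙 (D.bu A D.uI)) (D.buh (eta ≫ dl) (𝟙 D.uI)))
    ≫ eqToHom (show D.bu A (D.co (D.bu A D.uI) (D.bu (D.bu A A) D.uI))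
        = D.bu A (D.co (D.bu A D.uI) (D.bu A (D.bu A D.uI))) by simp [D.buA])
    ≫ D.buh (𝟙 A) (D.zt A D.uI A (D.bu A D.uI))
    ≫ eqToHom (show D.bu A (D.bu (D.co A A) (D.co D.uI (D.bu A D.uI)))
        = D.bu (D.bu (D.bu A (D.co A A)) A) D.uI by simp [D.coL, D.buA])
    ≫ D.buh (D.buh (D.buh (𝟙 A) mu) (𝟙 A)) (𝟙 D.uI)
  = D.dlI ≫ D.buh eta (𝟙 D.uI) ≫ D.buh dl (𝟙 D.uI) ≫ D.buh (D.buh dl (𝟙 A)) (𝟙 D.uI)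

/-- Axiom (LRC). -/
def LRCeq (A : M) (mu : D.co A A ⟶ A) (dl : A ⟶ D.bu A A) (ep : A ⟶ D.uJ) : Prop :=
  D.coh (D.coh (𝟙 (D.co D.uJ A)) dl) (𝟙 A)
    ≫ eqToHom (show D.co (D.co (D.co D.uJ A) (D.bu A A)) A
        = D.co (D.co (D.bu (D.co D.uJ A) D.uJ) (D.bu A A)) A by simp [D.buR])
    ≫ D.coh (D.zt (D.co D.uJ A) D.uJ A A) (𝟙 A)
    ≫ D.coh (D.buh (eqToHom (D.coA D.uJ A A) ≫ D.coh (𝟙 D.uJ) (mu ≫ ep))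
        (𝟙 (D.co D.uJ A))) (𝟙 A)
    ≫ D.coh (D.buh D.pw (𝟙 (D.co D.uJ A))) (𝟙 A)
    ≫ eqToHom (show D.co (D.bu D.uJ (D.co D.uJ A)) A = D.co D.uJ (D.co A A) by
        simp [D.buL, D.coA])
    ≫ D.coh (𝟙 D.uJ) (mu ≫ ep) ≫ D.pw
  = eqToHom (show D.co (D.co (D.co D.uJ A) A) A = D.co (D.co D.uJ A) (D.co A A) by
        simp [D.coA])
    ≫ D.coh (𝟙 (D.co D.uJ A)) mu
    ≫ eqToHom (D.coA D.uJ A A)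
    ≫ D.coh (𝟙 D.uJ) mu ≫ D.coh (𝟙 D.uJ) ep ≫ D.pw

/-- Axiom (LLC). -/
def LLCeq (A : M) (mu : D.co A A ⟶ A) (dl : A ⟶ D.bu A A) (ep : A ⟶ D.uJ) : Prop :=
  D.coh (D.coh (𝟙 (D.co D.uJ A)) dl) (𝟙 A)
    ≫ eqToHom (show D.co (D.co (D.co D.uJ A) (D.bu A A)) A
        = D.co (D.co (D.bu D.uJ (D.co D.uJ A)) (D.bu A A)) A by simp [D.buL])
    ≫ D.coh (D.zt D.uJ (D.co D.uJ A) A A) (𝟙 A)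
    ≫ D.coh (D.buh (𝟙 (D.co D.uJ A))
        (eqToHom (D.coA D.uJ A A) ≫ D.coh (𝟙 D.uJ) (mu ≫ ep))) (𝟙 A)
    ≫ D.coh (D.buh (𝟙 (D.co D.uJ A)) D.pw) (𝟙 A)
    ≫ eqToHom (show D.co (D.bu (D.co D.uJ A) D.uJ) A = D.co D.uJ (D.co A A) by
        simp [D.buR, D.coA])
    ≫ D.coh (𝟙 D.uJ) (mu ≫ ep) ≫ D.pw
  = eqToHom (show D.co (D.co (D.co D.uJ A) A) A = D.co (D.co D.uJ A) (D.co A A) by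
        simp [D.coA])
    ≫ D.coh (𝟙 (D.co D.uJ A)) mu
    ≫ eqToHom (D.coA D.uJ A A)
    ≫ D.coh (𝟙 D.uJ) mu ≫ D.coh (𝟙 D.uJ) ep ≫ D.pw

/-- Axiom (RLU), obtained from (RRU) by replacing `∘` by its opposite. -/
def RLUeq (A : M) (mu : D.co A A ⟶ A) (eta : D.uI ⟶ A) (dl : A ⟶ D.bu A A) : Prop :=
  D.dlI ≫ D.buh (𝟙 D.uI) (eta ≫ dl)
    ≫ eqToHom (show D.bu D.uI (D.bu A A) = D.bu (D.co D.uI (D.bu D.uI A)) A by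
        simp [D.coL, D.buA])
    ≫ D.buh (D.coh D.dlI (𝟙 (D.bu D.uI A))) (𝟙 A)
    ≫ D.buh (D.coh (D.buh (𝟙 D.uI) (eta ≫ dl)) (𝟙 (D.bu D.uI A))) (𝟙 A)
    ≫ eqToHom (show D.bu (D.co (D.bu D.uI (D.bu A A)) (D.bu D.uI A)) A
        = D.bu (D.co (D.bu (D.bu D.uI A) A) (D.bu D.uI A)) A by simp [D.buA])
    ≫ D.buh (D.zt (D.bu D.uI A) A D.uI A) (𝟙 A)
    ≫ eqToHom (show D.bu (D.bu (D.co (D.bu D.uI A) D.uI) (D.co A A)) A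
        = D.bu (D.bu (D.bu D.uI A) (D.co A A)) A by simp [D.coR])
    ≫ D.buh (D.buh (𝟙 (D.bu D.uI A)) mu) (𝟙 A)
  = D.dlI ≫ D.buh (𝟙 D.uI) eta ≫ D.buh (𝟙 D.uI) dl
    ≫ eqToHom (show D.bu D.uI (D.bu A A) = D.bu (D.bu D.uI A) A by simp [D.buA])
    ≫ D.buh (𝟙 (D.bu D.uI A)) dl
    ≫ eqToHom (show D.bu (D.bu D.uI A) (D.bu A A)
        = D.bu (D.bu (D.bu D.uI A) A) A by simp [D.buA])

/-- Axiom (LLU), obtained from (LRU) by replacing `∘` by its opposite. -/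
def LLUeq (A : M) (mu : D.co A A ⟶ A) (eta : D.uI ⟶ A) (dl : A ⟶ D.bu A A) : Prop :=
  D.dlI ≫ D.buh (eta ≫ dl) (𝟙 D.uI)
    ≫ eqToHom (show D.bu (D.bu A A) D.uI = D.bu A (D.co D.uI (D.bu A D.uI)) by
        simp [D.coL, D.buA])
    ≫ D.buh (𝟙 A) (D.coh D.dlI (𝟙 (D.bu A D.uI)))
    ≫ D.buh (𝟙 A) (D.coh (D.buh (eta ≫ dl) (𝟙 D.uI)) (𝟙 (D.bu A D.uI)))
    ≫ eqToHom (show D.bu A (D.co (D.bu (D.bu A A) D.uI) (D.bu A D.uI))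
        = D.bu A (D.co (D.bu A (D.bu A D.uI)) (D.bu A D.uI)) by simp [D.buA])
    ≫ D.buh (𝟙 A) (D.zt A (D.bu A D.uI) A D.uI)
    ≫ eqToHom (show D.bu A (D.bu (D.co A A) (D.co (D.bu A D.uI) D.uI))
        = D.bu (D.bu (D.bu A (D.co A A)) A) D.uI by simp [D.coR, D.buA])
    ≫ D.buh (D.buh (D.buh (𝟙 A) mu) (𝟙 A)) (𝟙 D.uI)
  = D.dlI ≫ D.buh eta (𝟙 D.uI) ≫ D.buh dl (𝟙 D.uI) ≫ D.buh (D.buh dl (𝟙 A)) (𝟙 D.uI)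

/-- Axiom (RRC), obtained from (LLC) by replacing `∘` by its opposite. -/
def RRCeq (A : M) (mu : D.co A A ⟶ A) (dl : A ⟶ D.bu A A) (ep : A ⟶ D.uJ) : Prop :=
  D.coh (D.coh (D.coh (𝟙 A) dl) (𝟙 A)) (𝟙 D.uJ)
    ≫ eqToHom (show D.co (D.co (D.co A (D.bu A A)) A) D.uJ
        = D.co A (D.co (D.bu A A) (D.bu (D.co A D.uJ) D.uJ)) by simp [D.coA, D.buR])
    ≫ D.coh (𝟙 A) (D.zt A A (D.co A D.uJ) D.uJ)
    ≫ D.coh (𝟙 A) (D.buh (eqToHom (D.coA A A D.uJ).symm ≫ D.coh (mu ≫ ep) (𝟙 D.uJ))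
        (𝟙 (D.co A D.uJ)))
    ≫ D.coh (𝟙 A) (D.buh D.pw (𝟙 (D.co A D.uJ)))
    ≫ eqToHom (show D.co A (D.bu D.uJ (D.co A D.uJ)) = D.co (D.co A A) D.uJ by
        simp [D.buL, D.coA])
    ≫ D.coh (mu ≫ ep) (𝟙 D.uJ) ≫ D.pw
  = D.coh (D.coh mu (𝟙 A)) (𝟙 D.uJ) ≫ D.coh mu (𝟙 D.uJ) ≫ D.coh ep (𝟙 D.uJ) ≫ D.pw

/-- Axiom (RLC), obtained from (LRC) by replacing `∘` by its opposite. -/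
def RLCeq (A : M) (mu : D.co A A ⟶ A) (dl : A ⟶ D.bu A A) (ep : A ⟶ D.uJ) : Prop :=
  D.coh (D.coh (D.coh (𝟙 A) dl) (𝟙 A)) (𝟙 D.uJ)
    ≫ eqToHom (show D.co (D.co (D.co A (D.bu A A)) A) D.uJ
        = D.co A (D.co (D.bu A A) (D.bu D.uJ (D.co A D.uJ))) by simp [D.coA, D.buL])
    ≫ D.coh (𝟙 A) (D.zt A A D.uJ (D.co A D.uJ))
    ≫ D.coh (𝟙 A) (D.buh (𝟙 (D.co A D.uJ))
        (eqToHom (D.coA A A D.uJ).symm ≫ D.coh (mu ≫ ep) (𝟙 D.uJ)))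
    ≫ D.coh (𝟙 A) (D.buh (𝟙 (D.co A D.uJ)) D.pw)
    ≫ eqToHom (show D.co A (D.bu (D.co A D.uJ) D.uJ) = D.co (D.co A A) D.uJ by
        simp [D.buR, D.coA])
    ≫ D.coh (mu ≫ ep) (𝟙 D.uJ) ≫ D.pw
  = D.coh (D.coh mu (𝟙 A)) (𝟙 D.uJ) ≫ D.coh mu (𝟙 D.uJ) ≫ D.coh ep (𝟙 D.uJ) ≫ D.pw

end Duo

/-- A right weak bimonoid in a duoidal category. -/
structure RWB {M : Type u} [Category.{v} M] (D : Duo M) where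
  A : M
  mu : D.co A A ⟶ A
  eta : D.uI ⟶ A
  dl : A ⟶ D.bu A A
  ep : A ⟶ D.uJ
  mu_assoc : D.coh mu (𝟙 A) ≫ mu = eqToHom (D.coA A A A) ≫ D.coh (𝟙 A) mu ≫ mu
  mu_unitL : eqToHom (D.coL A).symm ≫ D.coh eta (𝟙 A) ≫ mu = 𝟙 A
  mu_unitR : eqToHom (D.coR A).symm ≫ D.coh (𝟙 A) eta ≫ mu = 𝟙 A
  dl_coassoc : dl ≫ D.buh dl (𝟙 A) ≫ eqToHom (D.buA A A A) = dl ≫ D.buh (𝟙 A) dl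
  dl_counitL : dl ≫ D.buh ep (𝟙 A) ≫ eqToHom (D.buL A) = 𝟙 A
  dl_counitR : dl ≫ D.buh (𝟙 A) ep ≫ eqToHom (D.buR A) = 𝟙 A
  wb : D.WBeq A mu dl
  rru : D.RRUeq A mu eta dl
  lru : D.LRUeq A mu eta dl
  lrc : D.LRCeq A mu dl ep
  llc : D.LLCeq A mu dl ep

/-- A weak bimonoid: both a right weak bimonoid and a left weak bimonoid. -/
structure WBim {M : Type u} [Category.{v} M] (D : Duo M) extends RWB D where
  rlu : D.RLUeq A mu eta dl
  llu : D.LLUeq A mu eta dl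
  rlc : D.RLCeq A mu dl ep
  rrc : D.RRCeq A mu dl ep

/-- Idempotent morphisms split in `M`. -/
def SplitIdem (M : Type u) [Category.{v} M] : Prop :=
  ∀ ⦃X : M⦄ (e : X ⟶ X), e ≫ e = e →
    ∃ (Y : M) (p : X ⟶ Y) (i : Y ⟶ X), p ≫ i = e ∧ i ≫ p = 𝟙 Y

namespace RWB

variable {M : Type u} [Category.{v} M] {D : Duo M} (W : RWB D)

/-- The object `J∘A`. -/
def JA : M := D.co D.uJ W.A

/-- The idempotent morphism `⊓^R_∘ :=
((J∘A)•ϖ).((J∘A)•(J∘(ε.μ))).ζ.(J∘A∘(Δ.η)) : J∘A ⟶ J∘A`. -/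
def sqcapR : W.JA ⟶ W.JA :=
  eqToHom (show W.JA = D.co W.JA D.uI by simp [D.coR])
    ≫ D.coh (𝟙 W.JA) (W.eta ≫ W.dl)
    ≫ eqToHom (show D.co W.JA (D.bu W.A W.A)
        = D.co (D.bu D.uJ W.JA) (D.bu W.A W.A) by simp [D.buL])
    ≫ D.zt D.uJ W.JA W.A W.A
    ≫ D.buh (𝟙 W.JA) (eqToHom (D.coA D.uJ W.A W.A) ≫ D.coh (𝟙 D.uJ) (W.mu ≫ W.ep))
    ≫ D.buh (𝟙 W.JA) D.pw
    ≫ eqToHom (D.buR W.JA)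

/-- The natural idempotent `χ^R_{F,G} = (φ•γ).ζ.((F•G)∘(Δ.η))` on `F•G`, for right
`A`-modules `(F,f)` and `(G,g)`. -/
def chiR (F G : M) (f : D.co F W.A ⟶ F) (g : D.co G W.A ⟶ G) :
    D.bu F G ⟶ D.bu F G :=
  eqToHom (show D.bu F G = D.co (D.bu F G) D.uI by simp [D.coR])
    ≫ D.coh (𝟙 (D.bu F G)) (W.eta ≫ W.dl)
    ≫ D.zt F G W.A W.A
    ≫ D.buh f g

/-- The morphism `J∘η : J ⟶ J∘A`. -/
def jeta : D.uJ ⟶ W.JA :=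
  eqToHom (D.coR D.uJ).symm ≫ D.coh (𝟙 D.uJ) W.eta

/-- The morphism `(π^R_∘).(τ∘A) : A ⟶ R_∘` needs `τ∘A : A ⟶ J∘A`. -/
def tauA : W.A ⟶ W.JA :=
  eqToHom (D.coL W.A).symm ≫ D.coh D.tau (𝟙 W.A)

section Retract

variable (R : M) (p : W.JA ⟶ R) (i : R ⟶ W.JA)

/-- The right `A`-action `γ_A = π^R_∘.(J∘μ).(ι^R_∘ ∘ A)` on the retract `R_∘`. -/
def gamA : D.co R W.A ⟶ R :=
  D.coh i (𝟙 W.A) ≫ eqToHom (D.coA D.uJ W.A W.A) ≫ D.coh (𝟙 D.uJ) W.mu ≫ p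

/-- The left `J`-action `γ_J = π^R_∘.(ϖ∘A).(J∘ι^R_∘)` on the retract `R_∘`. -/
def gamJ : D.co D.uJ R ⟶ R :=
  D.coh (𝟙 D.uJ) i ≫ eqToHom (D.coA D.uJ D.uJ W.A).symm ≫ D.coh D.pw (𝟙 W.A) ≫ p

/-- The multiplication `μ^R_∘ = (R∘•ϖ).(R∘•(J∘ε)).(R∘•ι^R_∘).χ^R_{R∘,R∘}`. -/
def muR : D.bu R R ⟶ R :=
  W.chiR R R (W.gamA R p i) (W.gamA R p i)
    ≫ D.buh (𝟙 R) i
    ≫ D.buh (𝟙 R) (D.coh (𝟙 D.uJ) W.ep)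
    ≫ D.buh (𝟙 R) D.pw
    ≫ eqToHom (D.buR R)

/-- The unit `η^R_∘ = π^R_∘.(J∘η)`. -/
def etaR : D.uJ ⟶ R := W.jeta ≫ p

/-- The comultiplication `Δ^R_∘ = χ^R_{R∘,R∘}.(R∘•π^R_∘).(R∘•(J∘η))`. -/
def DeltaR : R ⟶ D.bu R R :=
  eqToHom (D.buR R).symm
    ≫ D.buh (𝟙 R) W.jeta
    ≫ D.buh (𝟙 R) p
    ≫ W.chiR R R (W.gamA R p i) (W.gamA R p i)

/-- The counit `ε^R_∘ = ϖ.(J∘ε).ι^R_∘`. -/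
def epsR : R ⟶ D.uJ := i ≫ D.coh (𝟙 D.uJ) W.ep ≫ D.pw

end Retract

/-- The comultiplication-type morphism `ζ.(J∘Δ) : J∘A ⟶ (J∘A)•(J∘A)`. -/
def coact0 : W.JA ⟶ D.bu W.JA W.JA :=
  D.coh (𝟙 D.uJ) W.dl
    ≫ eqToHom (show D.co D.uJ (D.bu W.A W.A)
        = D.co (D.bu D.uJ D.uJ) (D.bu W.A W.A) by simp [D.buL])
    ≫ D.zt D.uJ D.uJ W.A W.A

end RWB

/-- A morphism of `M` together with its source and target; equations of arrows do not see
equality casts. -/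
structure Arr (M : Type u) [Category.{v} M] where
  /-- The source. -/
  {left : M}
  /-- The target. -/
  {right : M}
  /-- The morphism. -/
  hom : left ⟶ right

namespace Arr

variable {M : Type u} [Category.{v} M]

theorem mk_injective {X Y : M} {f g : X ⟶ Y} (h : mk f = mk g) : f = g := by
  cases h; rfl

open Classical in
/-- Composition of arrows whose middle objects are equal; `a` itself if they are not. -/
noncomputable def chain (a b : Arr M) : Arr M :=
  if h : a.right = b.left then mk (a.hom ≫ eqToHom h ≫ b.hom) else a

local infixr:60 "⨾" => chain

@[simp] theorem chain_left (a b : Arr M) : (a ⨾ b).left = a.left := by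
  unfold chain; split <;> rfl

@[simp] theorem chain_right {a b : Arr M} (h : a.right = b.left) : (a ⨾ b).right = b.right := by
  simp [chain, h]

theorem mk_comp {X Y Z : M} (f : X ⟶ Y) (g : Y ⟶ Z) : mk (f ≫ g) = mk f ⨾ mk g := by
  simp [chain]

theorem mk_eqToHom {X Y : M} (h : X = Y) : mk (eqToHom h) = mk (𝟙 X) := by
  subst h; rfl

theorem id_chain {X : M} {a : Arr M} (h : X = a.left) : mk (𝟙 X) ⨾ a = a := by
  subst h; simp [chain]

theorem chain_id {X : M} {a : Arr M} (h : a.right = X) : a ⨾ mk (𝟙 X) = a := by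
  subst h; simp [chain]

theorem chain_assoc {a b c : Arr M} (h : a.right = b.left) (k : b.right = c.left) :
    (a ⨾ b) ⨾ c = a ⨾ b ⨾ c := by
  obtain @⟨X, Y, f⟩ := a
  obtain @⟨Y', Z, g⟩ := b
  obtain @⟨Z', U, l⟩ := c
  obtain rfl : Y = Y' := h
  obtain rfl : Z = Z' := k
  simp only [← mk_comp, Category.assoc]

theorem chain_eq_assoc {a b c d x : Arr M} (e : a ⨾ b = c ⨾ d) (hab : a.right = b.left)
    (hbx : b.right = x.left) (hcd : c.right = d.left) (hdx : d.right = x.left) :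
    a ⨾ b ⨾ x = c ⨾ d ⨾ x := by
  rw [← chain_assoc hab hbx, e, chain_assoc hcd hdx]

end Arr

namespace Duo

open Arr

variable {M : Type u} [Category.{v} M] (D : Duo M)

/-- The product `∘` on arrows. -/
def coArr (a b : Arr M) : Arr M := Arr.mk (D.coh a.hom b.hom)

/-- The product `•` on arrows. -/
def buArr (a b : Arr M) : Arr M := Arr.mk (D.buh a.hom b.hom)

/-- The interchange law as an arrow. -/
def ztArr (P Q R S : M) : Arr M := Arr.mk (D.zt P Q R S)

local infixr:60 "⨾" => Arr.chain
local infixr:70 "⊚" => D.coArr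
local infixr:70 "⊡" => D.buArr
local notation "𝕀" X:max => Arr.mk (𝟙 X)

theorem mk_coh {X Y X' Y' : M} (f : X ⟶ Y) (g : X' ⟶ Y') :
    Arr.mk (D.coh f g) = Arr.mk f ⊚ Arr.mk g := rfl

theorem mk_buh {X Y X' Y' : M} (f : X ⟶ Y) (g : X' ⟶ Y') :
    Arr.mk (D.buh f g) = Arr.mk f ⊡ Arr.mk g := rfl

theorem mk_zt (P Q R S : M) : Arr.mk (D.zt P Q R S) = D.ztArr P Q R S := rfl

@[simp] theorem coArr_left (a b : Arr M) : (a ⊚ b).left = D.co a.left b.left := by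
  simp only [coArr]
@[simp] theorem coArr_right (a b : Arr M) : (a ⊚ b).right = D.co a.right b.right := by
  simp only [coArr]
@[simp] theorem buArr_left (a b : Arr M) : (a ⊡ b).left = D.bu a.left b.left := by
  simp only [buArr]
@[simp] theorem buArr_right (a b : Arr M) : (a ⊡ b).right = D.bu a.right b.right := by
  simp only [buArr]

@[simp] theorem ztArr_left (P Q R S : M) : (D.ztArr P Q R S).left = D.co (D.bu P Q) (D.bu R S) := by
  simp only [ztArr]
@[simp] theorem ztArr_right (P Q R S : M) :
    (D.ztArr P Q R S).right = D.bu (D.co P R) (D.co Q S) := by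
  simp only [ztArr]

theorem coArr_id (X Y : M) : 𝕀 X ⊚ 𝕀 Y = 𝕀 (D.co X Y) := congrArg Arr.mk (D.coh_id X Y)
theorem buArr_id (X Y : M) : 𝕀 X ⊡ 𝕀 Y = 𝕀 (D.bu X Y) := congrArg Arr.mk (D.buh_id X Y)

theorem mk_eqToHom_comp_comp {X X' Y Y' : M} (h : X = X') (f : X' ⟶ Y') (k : Y' = Y) :
    Arr.mk (eqToHom h ≫ f ≫ eqToHom k) = Arr.mk f := by
  subst h k; simp

theorem coArr_assoc (a b c : Arr M) : (a ⊚ b) ⊚ c = a ⊚ b ⊚ c :=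
  (congrArg Arr.mk (D.coh_assoc a.hom b.hom c.hom)).trans (mk_eqToHom_comp_comp _ _ _)

theorem buArr_assoc (a b c : Arr M) : (a ⊡ b) ⊡ c = a ⊡ b ⊡ c :=
  (congrArg Arr.mk (D.buh_assoc a.hom b.hom c.hom)).trans (mk_eqToHom_comp_comp _ _ _)

theorem uI_coArr (a : Arr M) : 𝕀 D.uI ⊚ a = a :=
  (congrArg Arr.mk (D.coh_unitL a.hom)).trans (mk_eqToHom_comp_comp _ _ _)

theorem coArr_uI (a : Arr M) : a ⊚ 𝕀 D.uI = a :=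
  (congrArg Arr.mk (D.coh_unitR a.hom)).trans (mk_eqToHom_comp_comp _ _ _)

theorem uJ_buArr (a : Arr M) : 𝕀 D.uJ ⊡ a = a :=
  (congrArg Arr.mk (D.buh_unitL a.hom)).trans (mk_eqToHom_comp_comp _ _ _)

theorem buArr_uJ (a : Arr M) : a ⊡ 𝕀 D.uJ = a :=
  (congrArg Arr.mk (D.buh_unitR a.hom)).trans (mk_eqToHom_comp_comp _ _ _)

theorem coArr_chain {a b c d : Arr M} (h : a.right = b.left) (k : c.right = d.left) :
    (a ⊚ c) ⨾ (b ⊚ d) = (a ⨾ b) ⊚ (c ⨾ d) := by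
  obtain @⟨X, Y, f⟩ := a
  obtain @⟨Y', Z, g⟩ := b
  obtain @⟨P, Q, l⟩ := c
  obtain @⟨Q', T, m⟩ := d
  obtain rfl : Y = Y' := h
  obtain rfl : Q = Q' := k
  simp only [← mk_comp, ← mk_coh, D.coh_comp]

theorem buArr_chain {a b c d : Arr M} (h : a.right = b.left) (k : c.right = d.left) :
    (a ⊡ c) ⨾ (b ⊡ d) = (a ⨾ b) ⊡ (c ⨾ d) := by
  obtain @⟨X, Y, f⟩ := a
  obtain @⟨Y', Z, g⟩ := b
  obtain @⟨P, Q, l⟩ := c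
  obtain @⟨Q', T, m⟩ := d
  obtain rfl : Y = Y' := h
  obtain rfl : Q = Q' := k
  simp only [← mk_comp, ← mk_buh, D.buh_comp]

theorem coArr_chain_assoc {a b c d x : Arr M} (h : a.right = b.left) (k : c.right = d.left)
    (l : (b ⊚ d).right = x.left) :
    (a ⊚ c) ⨾ (b ⊚ d) ⨾ x = (a ⨾ b) ⊚ (c ⨾ d) ⨾ x := by
  rw [← chain_assoc _ l, D.coArr_chain h k]
  simp [h, k]

theorem buArr_chain_assoc {a b c d x : Arr M} (h : a.right = b.left) (k : c.right = d.left)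
    (l : (b ⊡ d).right = x.left) :
    (a ⊡ c) ⨾ (b ⊡ d) ⨾ x = (a ⨾ b) ⊡ (c ⨾ d) ⨾ x := by
  rw [← chain_assoc _ l, D.buArr_chain h k]
  simp [h, k]

theorem ztArr_natural (a b c d : Arr M) :
    ((a ⊡ b) ⊚ (c ⊡ d)) ⨾ D.ztArr a.right b.right c.right d.right =
      D.ztArr a.left b.left c.left d.left ⨾ ((a ⊚ c) ⊡ (b ⊚ d)) :=
  (mk_comp _ _).symm.trans
    ((congrArg Arr.mk (D.zt_nat a.hom b.hom c.hom d.hom)).trans (mk_comp _ _))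

theorem ztArr_assoc (P Q R S T U : M) :
    D.ztArr (D.bu P Q) R (D.bu S T) U ⨾ (D.ztArr P Q S T ⊡ 𝕀 (D.co R U)) =
      D.ztArr P (D.bu Q R) S (D.bu T U) ⨾ (𝕀 (D.co P S) ⊡ D.ztArr Q R T U) := by
  have h := congrArg Arr.mk (D.zt_assoc2 P Q R S T U)
  simp only [mk_comp, mk_eqToHom, mk_buh, mk_zt] at h
  rw [h, id_chain, chain_id]
  all_goals simp [D.buA]

end Duo

namespace RWB

open Arr

attribute [local simp] Duo.coA Duo.buA Duo.coL Duo.coR Duo.buL Duo.buR JA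

variable {M : Type u} [Category.{v} M] {D : Duo M} (W : RWB D)

local infixr:60 "⨾" => Arr.chain
local infixr:70 "⊚" => D.coArr
local infixr:70 "⊡" => D.buArr
local notation "𝕀" X:max => Arr.mk (𝟙 X)

/-- The pairing `ϖ.(J∘(ε.μ)) : J∘A∘A ⟶ J`. -/
def pair : D.co D.uJ (D.co W.A W.A) ⟶ D.uJ := D.coh (𝟙 D.uJ) (W.mu ≫ W.ep) ≫ D.pw

/-- The arrow `(J∘A•k).ζ.(P∘(Δ.η)) : P ⟶ J∘A` induced by `k : P∘A ⟶ J`. -/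
noncomputable def sweep (P : M) (k : Arr M) : Arr M :=
  (𝕀 P ⊚ Arr.mk (W.eta ≫ W.dl)) ⨾ D.ztArr D.uJ P W.A W.A ⨾ (𝕀 (D.co D.uJ W.A) ⊡ k)

theorem mk_sqcapR : Arr.mk W.sqcapR = W.sweep (D.co D.uJ W.A) (Arr.mk W.pair) := by
  have e : Arr.mk W.sqcapR = Arr.mk (eqToHom (D.coR (D.co D.uJ W.A)).symm
      ≫ D.coh (𝟙 (D.co D.uJ W.A)) (W.eta ≫ W.dl)
      ≫ eqToHom (show D.co (D.co D.uJ W.A) (D.bu W.A W.A)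
          = D.co (D.bu D.uJ (D.co D.uJ W.A)) (D.bu W.A W.A) by simp)
      ≫ D.zt D.uJ (D.co D.uJ W.A) W.A W.A
      ≫ D.buh (𝟙 _) (eqToHom (D.coA D.uJ W.A W.A) ≫ D.coh (𝟙 D.uJ) (W.mu ≫ W.ep))
      ≫ D.buh (𝟙 _) D.pw
      ≫ eqToHom (D.buR _)) := rfl
  refine e.trans ?_
  simp only [sweep, pair, mk_comp, mk_eqToHom, Duo.mk_zt, Duo.mk_buh, Duo.mk_coh]
  rw [id_chain, id_chain, chain_id, D.buArr_chain, chain_id, id_chain]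
  all_goals simp [chain_right]

theorem chain_sweep (f k : Arr M) (h : D.co f.right W.A = k.left) :
    f ⨾ W.sweep f.right k = W.sweep f.left ((f ⊚ 𝕀 W.A) ⨾ k) := by
  unfold sweep
  have e : f ⨾ (𝕀 f.right ⊚ Arr.mk (W.eta ≫ W.dl)) =
      (𝕀 f.left ⊚ Arr.mk (W.eta ≫ W.dl)) ⨾ ((𝕀 D.uJ ⊡ f) ⊚ (𝕀 W.A ⊡ 𝕀 W.A)) := by
    conv_lhs => rw [← D.coArr_uI f]
    rw [D.uJ_buArr, D.buArr_id, D.coArr_chain, D.coArr_chain, id_chain, chain_id,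
      id_chain, chain_id]
    all_goals simp
  have n := D.ztArr_natural (𝕀 D.uJ) f (𝕀 W.A) (𝕀 W.A)
  simp only [] at n
  rw [← chain_assoc, e, chain_assoc, ← chain_assoc (b := D.ztArr _ _ _ _), n, chain_assoc,
    D.buArr_chain, D.coArr_id, id_chain]
  all_goals simp [← h]

attribute [local simp] id_chain chain_id chain_assoc Duo.coArr_chain Duo.coArr_chain_assoc
  Duo.buArr_chain Duo.buArr_chain_assoc Duo.coArr_id Duo.buArr_id Duo.coArr_uI Duo.uI_coArr
  Duo.buArr_uJ Duo.uJ_buArr Duo.mk_coh Duo.mk_buh Duo.mk_zt mk_comp mk_eqToHom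

theorem mk_pair :
    Arr.mk W.pair = (𝕀 D.uJ ⊚ (Arr.mk W.mu ⨾ Arr.mk W.ep)) ⨾ Arr.mk D.pw := by
  simp [pair]

theorem mu_assoc_arr :
    (Arr.mk W.mu ⊚ 𝕀 W.A) ⨾ Arr.mk W.mu = (𝕀 W.A ⊚ Arr.mk W.mu) ⨾ Arr.mk W.mu := by
  simpa using congrArg Arr.mk W.mu_assoc

theorem eta_mu : (Arr.mk W.eta ⊚ 𝕀 W.A) ⨾ Arr.mk W.mu = 𝕀 W.A := by
  simpa using congrArg Arr.mk W.mu_unitL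

theorem mu_eta : (𝕀 W.A ⊚ Arr.mk W.eta) ⨾ Arr.mk W.mu = 𝕀 W.A := by
  simpa using congrArg Arr.mk W.mu_unitR

theorem dl_coassoc_arr :
    Arr.mk W.dl ⨾ (Arr.mk W.dl ⊡ 𝕀 W.A) = Arr.mk W.dl ⨾ (𝕀 W.A ⊡ Arr.mk W.dl) := by
  simpa using congrArg Arr.mk W.dl_coassoc

theorem dl_ep : Arr.mk W.dl ⨾ (𝕀 W.A ⊡ Arr.mk W.ep) = 𝕀 W.A := by
  simpa using congrArg Arr.mk W.dl_counitR

theorem mu_dl :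
    Arr.mk W.mu ⨾ Arr.mk W.dl =
      (Arr.mk W.dl ⊚ Arr.mk W.dl) ⨾ D.ztArr W.A W.A W.A W.A ⨾ (Arr.mk W.mu ⊡ Arr.mk W.mu) := by
  simpa using congrArg Arr.mk W.wb

theorem llc_arr :
    ((𝕀 (D.co D.uJ W.A) ⊚ Arr.mk W.dl) ⨾ D.ztArr D.uJ (D.co D.uJ W.A) W.A W.A ⨾
        (𝕀 (D.co D.uJ W.A) ⊡ Arr.mk W.pair)) ⊚ 𝕀 W.A ⨾ Arr.mk W.pair =
      (𝕀 (D.co D.uJ W.A) ⊚ Arr.mk W.mu) ⨾ Arr.mk W.pair := by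
  have h := congrArg Arr.mk W.llc
  simp only [mk_comp, mk_eqToHom, Duo.mk_zt, Duo.mk_buh, Duo.mk_coh] at h
  simpa (maxDischargeDepth := 5) [mk_pair] using h

/-- The map `J∘A∘A ⟶ J∘A` that (LRC) compares with `J∘μ`. -/
noncomputable def lrcArr : Arr M :=
  (𝕀 (D.co D.uJ W.A) ⊚ Arr.mk W.dl) ⨾ D.ztArr (D.co D.uJ W.A) D.uJ W.A W.A ⨾
    (Arr.mk W.pair ⊡ 𝕀 (D.co D.uJ W.A))

theorem lrcArr_pair :
    (W.lrcArr ⊚ 𝕀 W.A) ⨾ Arr.mk W.pair = (𝕀 (D.co D.uJ W.A) ⊚ Arr.mk W.mu) ⨾ Arr.mk W.pair := by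
  have h := congrArg Arr.mk W.lrc
  simp only [mk_comp, mk_eqToHom, Duo.mk_zt, Duo.mk_buh, Duo.mk_coh] at h
  simpa (maxDischargeDepth := 5) [lrcArr, mk_pair] using h

theorem mu_pair :
    ((𝕀 D.uJ ⊚ Arr.mk W.mu) ⊚ 𝕀 W.A) ⨾ Arr.mk W.pair =
      (𝕀 (D.co D.uJ W.A) ⊚ Arr.mk W.mu) ⨾ Arr.mk W.pair := by
  have h : (Arr.mk W.mu ⊚ 𝕀 W.A) ⨾ Arr.mk W.mu ⨾ Arr.mk W.ep =
      (𝕀 W.A ⊚ Arr.mk W.mu) ⨾ Arr.mk W.mu ⨾ Arr.mk W.ep := by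
    rw [← chain_assoc, mu_assoc_arr, chain_assoc] <;> simp
  rw [mk_pair, ← D.coArr_id, D.coArr_assoc, D.coArr_assoc, D.coArr_chain_assoc, h]
  all_goals simp

theorem sqcapR_pair : (Arr.mk W.sqcapR ⊚ 𝕀 W.A) ⨾ Arr.mk W.pair = Arr.mk W.pair := by
  have h := congrArg (fun x => ((𝕀 (D.co D.uJ W.A) ⊚ Arr.mk W.eta) ⊚ 𝕀 W.A) ⨾ x) W.llc_arr
  have r : ((𝕀 (D.co D.uJ W.A) ⊚ Arr.mk W.eta) ⊚ 𝕀 W.A) ⨾ (𝕀 (D.co D.uJ W.A) ⊚ Arr.mk W.mu) ⨾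
      Arr.mk W.pair = Arr.mk W.pair := by
    rw [D.coArr_assoc]
    simp [eta_mu]
  refine Eq.trans ?_ (h.trans r)
  rw [mk_sqcapR]
  simp (maxDischargeDepth := 5) [sweep]

theorem chain_sqcapR_congr {f g : Arr M} (hl : f.left = g.left)
    (hf : f.right = D.co D.uJ W.A) (hg : g.right = D.co D.uJ W.A)
    (h : (f ⊚ 𝕀 W.A) ⨾ Arr.mk W.pair = (g ⊚ 𝕀 W.A) ⨾ Arr.mk W.pair) :
    f ⨾ Arr.mk W.sqcapR = g ⨾ Arr.mk W.sqcapR := by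
  have cf := W.chain_sweep f (Arr.mk W.pair) (by simp [hf])
  have cg := W.chain_sweep g (Arr.mk W.pair) (by simp [hg])
  rw [hf] at cf
  rw [hg] at cg
  rw [mk_sqcapR, cf, cg, h, hl]

theorem sqcapR_mu :
    (Arr.mk W.sqcapR ⊚ 𝕀 W.A) ⨾ (𝕀 D.uJ ⊚ Arr.mk W.mu) ⨾ Arr.mk W.sqcapR =
      (𝕀 D.uJ ⊚ Arr.mk W.mu) ⨾ Arr.mk W.sqcapR := by
  rw [← chain_assoc]
  · apply chain_sqcapR_congr
    · simp
    · simp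
    · simp
    · have h := congrArg (fun x => (𝕀 (D.co D.uJ W.A) ⊚ Arr.mk W.mu) ⨾ x) W.sqcapR_pair
      have h1 : (((Arr.mk W.sqcapR ⊚ 𝕀 W.A) ⨾ (𝕀 D.uJ ⊚ Arr.mk W.mu)) ⊚ 𝕀 W.A) ⨾ Arr.mk W.pair =
          (Arr.mk W.sqcapR ⊚ Arr.mk W.mu) ⨾ Arr.mk W.pair := by
        have h2 := congrArg (fun x => ((Arr.mk W.sqcapR ⊚ 𝕀 W.A) ⊚ 𝕀 W.A) ⨾ x) W.mu_pair
        refine Eq.trans (by simp (maxDischargeDepth := 5)) (h2.trans ?_)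
        rw [D.coArr_assoc]
        simp (maxDischargeDepth := 5)
      rw [h1, mu_pair, ← h]
      simp (maxDischargeDepth := 5)
  · simp
  · simp

theorem lrcArr_sqcapR :
    W.lrcArr ⨾ Arr.mk W.sqcapR = (𝕀 D.uJ ⊚ Arr.mk W.mu) ⨾ Arr.mk W.sqcapR := by
  apply chain_sqcapR_congr
  · simp [lrcArr]
  · simp [lrcArr]
  · simp
  · rw [lrcArr_pair, mu_pair]

theorem sqcapR_ep :
    Arr.mk W.sqcapR ⨾ (𝕀 D.uJ ⊚ Arr.mk W.ep) ⨾ Arr.mk D.pw =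
      (𝕀 D.uJ ⊚ Arr.mk W.ep) ⨾ Arr.mk D.pw := by
  have e : (𝕀 D.uJ ⊚ Arr.mk W.ep) ⨾ Arr.mk D.pw =
      (𝕀 (D.co D.uJ W.A) ⊚ Arr.mk W.eta) ⨾ Arr.mk W.pair := by
    rw [mk_pair, ← D.coArr_id, D.coArr_assoc, D.coArr_chain_assoc, ← chain_assoc, mu_eta]
    all_goals simp
  have h := congrArg (fun x => (𝕀 (D.co D.uJ W.A) ⊚ Arr.mk W.eta) ⨾ x) W.sqcapR_pair
  rw [e]
  refine Eq.trans ?_ h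
  conv_lhs => rw [← D.coArr_uI (Arr.mk W.sqcapR)]
  rw [D.coArr_chain_assoc, D.coArr_chain_assoc]
  all_goals simp

theorem mk_tauA : Arr.mk W.tauA = Arr.mk D.tau ⊚ 𝕀 W.A := by
  have e : Arr.mk W.tauA = Arr.mk (eqToHom (D.coL W.A).symm ≫ D.coh D.tau (𝟙 W.A)) := rfl
  refine e.trans ?_
  simp

theorem mk_jeta : Arr.mk W.jeta = 𝕀 D.uJ ⊚ Arr.mk W.eta := by
  have e : Arr.mk W.jeta = Arr.mk (eqToHom (D.coR D.uJ).symm ≫ D.coh (𝟙 D.uJ) W.eta) := rfl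
  refine e.trans ?_
  simp

theorem tau_pw : (Arr.mk D.tau ⊚ 𝕀 D.uJ) ⨾ Arr.mk D.pw = 𝕀 D.uJ := by
  simpa using congrArg Arr.mk D.pw_unitL

theorem tauA_ep : Arr.mk W.tauA ⨾ (𝕀 D.uJ ⊚ Arr.mk W.ep) ⨾ Arr.mk D.pw = Arr.mk W.ep := by
  have h : (Arr.mk D.tau ⊚ 𝕀 W.A) ⨾ (𝕀 D.uJ ⊚ Arr.mk W.ep) ⨾ Arr.mk D.pw =
      (𝕀 D.uI ⊚ Arr.mk W.ep) ⨾ (Arr.mk D.tau ⊚ 𝕀 D.uJ) ⨾ Arr.mk D.pw := by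
    rw [D.coArr_chain_assoc, D.coArr_chain_assoc]
    all_goals simp
  rw [mk_tauA, h, tau_pw]
  simp

/-- The map `(μ•(J∘A)).ζ.(A∘(Δ.η)) : A ⟶ A•(J∘A)`. -/
noncomputable def tauDl : Arr M :=
  (𝕀 W.A ⊚ Arr.mk (W.eta ≫ W.dl)) ⨾ D.ztArr W.A D.uJ W.A W.A ⨾
    (Arr.mk W.mu ⊡ 𝕀 (D.co D.uJ W.A))
theorem tauA_mu :
    (Arr.mk W.tauA ⊚ 𝕀 W.A) ⨾ (𝕀 D.uJ ⊚ Arr.mk W.mu) = Arr.mk W.mu ⨾ Arr.mk W.tauA := by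
  have h : (𝕀 D.uI ⊚ Arr.mk W.mu) ⨾ (Arr.mk D.tau ⊚ 𝕀 W.A) =
      (Arr.mk D.tau ⊚ 𝕀 W.A ⊚ 𝕀 W.A) ⨾ (𝕀 D.uJ ⊚ Arr.mk W.mu) := by
    rw [D.coArr_chain, D.coArr_chain]
    all_goals simp
  rw [mk_tauA, D.coArr_assoc, ← h, D.uI_coArr]

theorem tauA_pair : (Arr.mk W.tauA ⊚ 𝕀 W.A) ⨾ Arr.mk W.pair = Arr.mk W.mu ⨾ Arr.mk W.ep := by
  have h : Arr.mk W.pair = (𝕀 D.uJ ⊚ Arr.mk W.mu) ⨾ (𝕀 D.uJ ⊚ Arr.mk W.ep) ⨾ Arr.mk D.pw := by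
    rw [mk_pair, D.coArr_chain_assoc]
    all_goals simp
  rw [h, ← chain_assoc, tauA_mu, chain_assoc, tauA_ep]
  all_goals simp

theorem ztArr_tauA :
    (Arr.mk W.tauA ⊚ (𝕀 W.A ⊡ 𝕀 W.A)) ⨾ D.ztArr (D.co D.uJ W.A) D.uJ W.A W.A =
      D.ztArr W.A D.uJ W.A W.A ⨾ ((Arr.mk W.tauA ⊚ 𝕀 W.A) ⊡ 𝕀 (D.co D.uJ W.A)) := by
  have h := D.ztArr_natural (Arr.mk W.tauA) (𝕀 D.uJ) (𝕀 W.A) (𝕀 W.A)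
  simpa using h

theorem tauA_lrcArr :
    (Arr.mk W.tauA ⊚ 𝕀 W.A) ⨾ W.lrcArr =
      (𝕀 W.A ⊚ Arr.mk W.dl) ⨾ D.ztArr W.A D.uJ W.A W.A ⨾
        ((Arr.mk W.mu ⨾ Arr.mk W.ep) ⊡ 𝕀 (D.co D.uJ W.A)) := by
  have h : (Arr.mk W.tauA ⊚ 𝕀 W.A) ⨾ (𝕀 (D.co D.uJ W.A) ⊚ Arr.mk W.dl) =
      (𝕀 W.A ⊚ Arr.mk W.dl) ⨾ (Arr.mk W.tauA ⊚ (𝕀 W.A ⊡ 𝕀 W.A)) := by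
    rw [D.coArr_chain, D.coArr_chain]
    all_goals simp
  unfold lrcArr
  rw [chain_eq_assoc h, chain_eq_assoc W.ztArr_tauA, D.buArr_chain, tauA_pair]
  all_goals simp

theorem dl_dl_ztArr :
    (Arr.mk W.dl ⊚ (Arr.mk W.eta ⨾ Arr.mk W.dl)) ⨾ D.ztArr W.A W.A W.A W.A ⨾
        (𝕀 (D.co W.A W.A) ⊡ ((𝕀 W.A ⊚ Arr.mk W.dl) ⨾ D.ztArr W.A D.uJ W.A W.A)) =
      (𝕀 W.A ⊚ (Arr.mk W.eta ⨾ Arr.mk W.dl)) ⨾ D.ztArr W.A D.uJ W.A W.A ⨾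
        (((Arr.mk W.dl ⊚ Arr.mk W.dl) ⨾ D.ztArr W.A W.A W.A W.A) ⊡ 𝕀 (D.co D.uJ W.A)) := by
  have n₁ := D.ztArr_natural (𝕀 W.A) (𝕀 W.A) (𝕀 W.A) (Arr.mk W.dl)
  have n₂ := D.ztArr_natural (Arr.mk W.dl) (𝕀 D.uJ) (Arr.mk W.dl) (𝕀 W.A)
  have z := D.ztArr_assoc W.A W.A D.uJ W.A W.A W.A
  simp only [Duo.coArr_id, Duo.buArr_id, Duo.buArr_uJ] at n₁ n₂
  simp only [Duo.buR] at z
  have e₁ : 𝕀 (D.co W.A W.A) ⊡ ((𝕀 W.A ⊚ Arr.mk W.dl) ⨾ D.ztArr W.A D.uJ W.A W.A) =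
      (𝕀 (D.co W.A W.A) ⊡ (𝕀 W.A ⊚ Arr.mk W.dl)) ⨾
        (𝕀 (D.co W.A W.A) ⊡ D.ztArr W.A D.uJ W.A W.A) := by
    rw [D.buArr_chain] <;> simp
  have e₂ : ((Arr.mk W.dl ⊚ Arr.mk W.dl) ⨾ D.ztArr W.A W.A W.A W.A) ⊡ 𝕀 (D.co D.uJ W.A) =
      ((Arr.mk W.dl ⊚ Arr.mk W.dl) ⊡ 𝕀 (D.co D.uJ W.A)) ⨾
        (D.ztArr W.A W.A W.A W.A ⊡ 𝕀 (D.co D.uJ W.A)) := by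
    rw [D.buArr_chain] <;> simp
  rw [e₁, e₂, ← chain_eq_assoc n₁, ← chain_eq_assoc n₂, z, D.coArr_chain_assoc,
    D.coArr_chain_assoc, chain_assoc, chain_assoc, dl_coassoc_arr]
  all_goals simp

theorem dl_dl_mu_ep :
    (Arr.mk W.dl ⊚ Arr.mk W.dl) ⨾ D.ztArr W.A W.A W.A W.A ⨾
        (Arr.mk W.mu ⊡ (Arr.mk W.mu ⨾ Arr.mk W.ep)) = Arr.mk W.mu := by
  have h : Arr.mk W.mu ⊡ (Arr.mk W.mu ⨾ Arr.mk W.ep) =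
      (Arr.mk W.mu ⊡ Arr.mk W.mu) ⨾ (𝕀 W.A ⊡ Arr.mk W.ep) := by
    simp
  have e := congrArg (fun x => x ⨾ (𝕀 W.A ⊡ Arr.mk W.ep)) W.mu_dl
  beta_reduce at e
  rw [h]
  refine Eq.trans ?_ (e.symm.trans ?_)
  · rw [chain_assoc, chain_assoc]
    all_goals simp
  · rw [chain_assoc, dl_ep]
    all_goals simp

theorem dl_eq : Arr.mk W.dl =
    (Arr.mk W.dl ⊚ (Arr.mk W.eta ⨾ Arr.mk W.dl)) ⨾ D.ztArr W.A W.A W.A W.A ⨾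
      (Arr.mk W.mu ⊡ Arr.mk W.mu) := by
  have e := congrArg (fun x => (𝕀 W.A ⊚ Arr.mk W.eta) ⨾ x) W.mu_dl
  beta_reduce at e
  rw [← chain_assoc, mu_eta, id_chain, D.coArr_chain_assoc, id_chain] at e
  · exact e
  all_goals simp

theorem tauDl_sqcapR :
    W.tauDl ⨾ (𝕀 W.A ⊡ Arr.mk W.sqcapR) =
      Arr.mk W.dl ⨾ (𝕀 W.A ⊡ (Arr.mk W.tauA ⨾ Arr.mk W.sqcapR)) := by
  have e₁ : Arr.mk W.mu ⨾ Arr.mk W.tauA ⨾ Arr.mk W.sqcapR =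
      ((𝕀 W.A ⊚ Arr.mk W.dl) ⨾ D.ztArr W.A D.uJ W.A W.A) ⨾
        ((Arr.mk W.mu ⨾ Arr.mk W.ep) ⊡ 𝕀 (D.co D.uJ W.A)) ⨾ Arr.mk W.sqcapR := by
    rw [← chain_eq_assoc W.tauA_mu, ← lrcArr_sqcapR, ← chain_assoc, tauA_lrcArr]
    all_goals simp [lrcArr]
  have e₂ : (Arr.mk W.mu ⊡ Arr.mk W.mu) ⨾ (𝕀 W.A ⊡ (Arr.mk W.tauA ⨾ Arr.mk W.sqcapR)) =
      (𝕀 (D.co W.A W.A) ⊡ ((𝕀 W.A ⊚ Arr.mk W.dl) ⨾ D.ztArr W.A D.uJ W.A W.A)) ⨾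
        (Arr.mk W.mu ⊡ ((Arr.mk W.mu ⨾ Arr.mk W.ep) ⊡ 𝕀 (D.co D.uJ W.A))) ⨾
          (𝕀 W.A ⊡ Arr.mk W.sqcapR) := by
    rw [D.buArr_chain, D.buArr_chain, D.buArr_chain, e₁]
    all_goals simp
  have e₃ : (((Arr.mk W.dl ⊚ Arr.mk W.dl) ⨾ D.ztArr W.A W.A W.A W.A) ⊡ 𝕀 (D.co D.uJ W.A)) ⨾
      (Arr.mk W.mu ⊡ ((Arr.mk W.mu ⨾ Arr.mk W.ep) ⊡ 𝕀 (D.co D.uJ W.A))) =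
      Arr.mk W.mu ⊡ 𝕀 (D.co D.uJ W.A) := by
    rw [← D.buArr_assoc, D.buArr_chain, chain_assoc, dl_dl_mu_ep]
    all_goals simp
  have e₄ := congrArg (fun x => x ⨾ (Arr.mk W.mu ⊡ ((Arr.mk W.mu ⨾ Arr.mk W.ep) ⊡
    𝕀 (D.co D.uJ W.A))) ⨾ (𝕀 W.A ⊡ Arr.mk W.sqcapR)) W.dl_dl_ztArr
  beta_reduce at e₄
  conv_rhs => rw [dl_eq]
  rw [chain_assoc, chain_assoc, e₂]
  rw [chain_assoc, chain_assoc, chain_assoc, chain_assoc,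
    ← chain_assoc (a := _ ⊡ 𝕀 (D.co D.uJ W.A)), e₃] at e₄
  · rw [e₄, tauDl, chain_assoc, chain_assoc, mk_comp]
    all_goals simp
  all_goals simp

section Retract

variable {R : M} {p : W.JA ⟶ R} {i : R ⟶ W.JA}

theorem mk_gamA : Arr.mk (W.gamA R p i) =
    (Arr.mk i ⊚ 𝕀 W.A) ⨾ (𝕀 D.uJ ⊚ Arr.mk W.mu) ⨾ Arr.mk p := by
  have key (q : D.co D.uJ W.A ⟶ R) (j : R ⟶ D.co D.uJ W.A) :
      Arr.mk (D.coh j (𝟙 W.A) ≫ eqToHom (D.coA D.uJ W.A W.A) ≫ D.coh (𝟙 D.uJ) W.mu ≫ q) =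
        (Arr.mk j ⊚ 𝕀 W.A) ⨾ (𝕀 D.uJ ⊚ Arr.mk W.mu) ⨾ Arr.mk q := by
    simp
  exact key p i

theorem sqcapR_chain (hpi : p ≫ i = W.sqcapR) (hip : i ≫ p = 𝟙 R) :
    Arr.mk W.sqcapR ⨾ Arr.mk p = Arr.mk p := by
  rw [← hpi, ← mk_comp, Category.assoc, hip, Category.comp_id]

theorem retract_gamA (hpi : p ≫ i = W.sqcapR) (hip : i ≫ p = 𝟙 R) :
    (Arr.mk p ⊚ 𝕀 W.A) ⨾ Arr.mk (W.gamA R p i) = (𝕀 D.uJ ⊚ Arr.mk W.mu) ⨾ Arr.mk p := by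
  have h := congrArg (fun x => x ⨾ Arr.mk p) W.sqcapR_mu
  have s : (Arr.mk p ⊚ 𝕀 W.A) ⨾ (Arr.mk i ⊚ 𝕀 W.A) = Arr.mk W.sqcapR ⊚ 𝕀 W.A := by
    rw [D.coArr_chain, ← mk_comp, hpi, id_chain] <;> simp
  beta_reduce at h
  rw [chain_assoc, chain_assoc, W.sqcapR_chain hpi hip, ← s, chain_assoc] at h
  · rw [mk_gamA, h]
  all_goals simp

theorem buArr_chiR {X Y : M} (f : X ⟶ R) (g : Y ⟶ R) (γ : D.co R W.A ⟶ R) :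
    (Arr.mk f ⊡ Arr.mk g) ⨾ Arr.mk (W.chiR R R γ γ) =
      (𝕀 (D.bu X Y) ⊚ Arr.mk (W.eta ≫ W.dl)) ⨾ D.ztArr X Y W.A W.A ⨾
        (((Arr.mk f ⊚ 𝕀 W.A) ⨾ Arr.mk γ) ⊡ ((Arr.mk g ⊚ 𝕀 W.A) ⨾ Arr.mk γ)) := by
  have n := D.ztArr_natural (Arr.mk f) (Arr.mk g) (𝕀 W.A) (𝕀 W.A)
  simp only [] at n
  have e : (Arr.mk f ⊡ Arr.mk g) ⨾ (𝕀 (D.bu R R) ⊚ Arr.mk (W.eta ≫ W.dl)) =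
      (𝕀 (D.bu X Y) ⊚ Arr.mk (W.eta ≫ W.dl)) ⨾
        ((Arr.mk f ⊡ Arr.mk g) ⊚ (𝕀 W.A ⊡ 𝕀 W.A)) := by
    conv_lhs => rw [← D.coArr_uI (Arr.mk f ⊡ Arr.mk g)]
    rw [D.coArr_chain, D.coArr_chain, D.buArr_id, id_chain, chain_id, id_chain, chain_id]
    all_goals simp
  have c : Arr.mk (W.chiR R R γ γ) = (𝕀 (D.bu R R) ⊚ Arr.mk (W.eta ≫ W.dl)) ⨾
      D.ztArr R R W.A W.A ⨾ (Arr.mk γ ⊡ Arr.mk γ) := by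
    unfold chiR
    simp
  rw [c, chain_eq_assoc e, chain_eq_assoc n, D.buArr_chain]
  all_goals simp

theorem tauA_DeltaR (hpi : p ≫ i = W.sqcapR) (hip : i ≫ p = 𝟙 R) :
    Arr.mk W.tauA ⨾ Arr.mk p ⨾ Arr.mk (W.DeltaR R p i) =
      Arr.mk W.dl ⨾ ((Arr.mk W.tauA ⨾ Arr.mk p) ⊡ (Arr.mk W.tauA ⨾ Arr.mk p)) := by
  have e : Arr.mk (W.DeltaR R p i) = (𝕀 R ⊡ (Arr.mk W.jeta ⨾ Arr.mk p)) ⨾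
      Arr.mk (W.chiR R R (W.gamA R p i) (W.gamA R p i)) := by
    unfold DeltaR
    simp only [mk_comp, mk_eqToHom, Duo.mk_buh]
    rw [id_chain, D.buArr_chain_assoc, id_chain]
    all_goals simp
  have f₁ : Arr.mk W.tauA ⨾ Arr.mk p ⨾ (𝕀 R ⊡ (Arr.mk W.jeta ⨾ Arr.mk p)) =
      (Arr.mk W.tauA ⨾ Arr.mk p) ⊡ (Arr.mk W.jeta ⨾ Arr.mk p) := by
    conv_lhs => rw [← D.buArr_uJ (Arr.mk W.tauA), ← D.buArr_uJ (Arr.mk p)]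
    rw [D.buArr_chain, D.buArr_chain]
    all_goals simp
  have g₁ : ((Arr.mk W.tauA ⨾ Arr.mk p) ⊚ 𝕀 W.A) ⨾ Arr.mk (W.gamA R p i) =
      Arr.mk W.mu ⨾ Arr.mk W.tauA ⨾ Arr.mk p := by
    have h := congrArg (fun x => (Arr.mk W.tauA ⊚ 𝕀 W.A) ⨾ x) (W.retract_gamA hpi hip)
    beta_reduce at h
    rw [D.coArr_chain_assoc, chain_eq_assoc W.tauA_mu, id_chain] at h
    · exact h
    all_goals simp
  have g₂ : ((Arr.mk W.jeta ⨾ Arr.mk p) ⊚ 𝕀 W.A) ⨾ Arr.mk (W.gamA R p i) = Arr.mk p := by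
    have h := congrArg (fun x => (Arr.mk W.jeta ⊚ 𝕀 W.A) ⨾ x) (W.retract_gamA hpi hip)
    beta_reduce at h
    have k : (Arr.mk W.jeta ⊚ 𝕀 W.A) ⨾ (𝕀 D.uJ ⊚ Arr.mk W.mu) = 𝕀 (D.co D.uJ W.A) := by
      rw [mk_jeta, D.coArr_assoc, D.coArr_chain, eta_mu]
      all_goals simp
    rw [D.coArr_chain_assoc, ← chain_assoc, k, id_chain, id_chain] at h
    · exact h
    all_goals simp
  have x := W.buArr_chiR (W.tauA ≫ p) (W.jeta ≫ p) (W.gamA R p i)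
  rw [mk_comp W.tauA, mk_comp W.jeta, g₁, g₂, D.buR] at x
  have h₁ : Arr.mk W.tauA ⨾ Arr.mk p ⨾ Arr.mk (W.DeltaR R p i) =
      W.tauDl ⨾ ((Arr.mk W.tauA ⨾ Arr.mk p) ⊡ Arr.mk p) := by
    rw [e, ← chain_assoc, ← chain_assoc, chain_assoc (a := Arr.mk W.tauA), f₁, x, tauDl,
      chain_assoc, chain_assoc, D.buArr_chain, id_chain]
    all_goals simp
  have h₂ := congrArg (fun x => x ⨾ ((Arr.mk W.tauA ⨾ Arr.mk p) ⊡ Arr.mk p)) W.tauDl_sqcapR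
  beta_reduce at h₂
  rw [chain_assoc, chain_assoc, D.buArr_chain, D.buArr_chain, id_chain, chain_assoc,
    W.sqcapR_chain hpi hip] at h₂
  · exact h₁.trans h₂
  all_goals simp [tauDl]

theorem tauA_epsR (hpi : p ≫ i = W.sqcapR) :
    Arr.mk W.tauA ⨾ Arr.mk p ⨾ Arr.mk (W.epsR R i) = Arr.mk W.ep := by
  have key (j : R ⟶ D.co D.uJ W.A) : Arr.mk (j ≫ D.coh (𝟙 D.uJ) W.ep ≫ D.pw) =
      Arr.mk j ⨾ (𝕀 D.uJ ⊚ Arr.mk W.ep) ⨾ Arr.mk D.pw := by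
    simp
  have e : Arr.mk (W.epsR R i) = Arr.mk i ⨾ (𝕀 D.uJ ⊚ Arr.mk W.ep) ⨾ Arr.mk D.pw := key i
  rw [e, ← chain_assoc (a := Arr.mk p), ← mk_comp, hpi, sqcapR_ep, tauA_ep]
  all_goals simp

end Retract

end RWB

/-- **Statement 7.**  For a right weak bimonoid `A` in a duoidal category with split
idempotents and a fixed splitting of `⊓^R_∘` through `R_∘`, the composite
`π^R_∘.(τ∘A) : A ⟶ R_∘` is a morphism of comonoids in `(M,•)` from `(A,Δ,ε)` to
`(R_∘,Δ^R_∘,ε^R_∘)`. -/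
theorem comonoid_morphism_to_R
    {M : Type u} [Category.{v} M] (D : Duo M) (W : RWB D)
    (hsplit : SplitIdem M)
    (R : M) (p : W.JA ⟶ R) (i : R ⟶ W.JA)
    (hpi : p ≫ i = W.sqcapR) (hip : i ≫ p = 𝟙 R) :
    ((W.tauA ≫ p) ≫ W.DeltaR R p i
        = W.dl ≫ D.buh (W.tauA ≫ p) (W.tauA ≫ p)) ∧
    ((W.tauA ≫ p) ≫ W.epsR R i = W.ep) := by
  constructor
  · apply Arr.mk_injective
    rw [Category.assoc, Arr.mk_comp, Arr.mk_comp, Arr.mk_comp, D.mk_buh, Arr.mk_comp]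
    exact W.tauA_DeltaR hpi hip
  · apply Arr.mk_injective
    rw [Category.assoc, Arr.mk_comp, Arr.mk_comp]
    exact W.tauA_epsR hpi
end

section
/- Let A be a right weak bimonoid in a duoidal category (M,∘,I,•,J) in which idempotent morphisms split. Then R_∘ is a J-A bimodule in (M,∘): the left J-action γ_J := π^R_∘.(ϖ∘A).(J∘ι^R_∘) : J∘R_∘ → R_∘ and the right A-action γ_A := π^R_∘.(J∘μ).(ι^R_∘∘A) : R_∘∘A → R_∘ are unital (γ_J.(τ∘R_∘) = id, γ_A.(R_∘∘η) = id) and associative (γ_J.(ϖ∘R_∘) = γ_J.(J∘γ_J), γ_A.(γ_A∘A) = γ_A.(R_∘∘μ)), and they commute: γ_A.(γ_J∘A) = γ_J.(J∘γ_A). -/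
open CategoryTheory

universe v u

namespace Duo

variable {M : Type u} [Category.{v} M] (D : Duo M)

theorem coh_eqToHom {X X' Y Y' : M} (h : X = X') (k : Y = Y') :
    D.coh (eqToHom h) (eqToHom k) = eqToHom (by rw [h, k]) := by
  subst h k; simp [D.coh_id]

theorem coh_id_eqToHom (X : M) {Y Y' : M} (k : Y = Y') :
    D.coh (𝟙 X) (eqToHom k) = eqToHom (by rw [k]) :=
  D.coh_eqToHom rfl k

theorem coh_eqToHom_id (X : M) {Y Y' : M} (k : Y = Y') :
    D.coh (eqToHom k) (𝟙 X) = eqToHom (by rw [k]) :=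
  D.coh_eqToHom k rfl

theorem buh_eqToHom {X X' Y Y' : M} (h : X = X') (k : Y = Y') :
    D.buh (eqToHom h) (eqToHom k) = eqToHom (by rw [h, k]) := by
  subst h k; simp [D.buh_id]

theorem coh_id_comp (X : M) {Y Y' Y'' : M} (f : Y ⟶ Y') (g : Y' ⟶ Y'') :
    D.coh (𝟙 X) (f ≫ g) = D.coh (𝟙 X) f ≫ D.coh (𝟙 X) g := by
  simpa using D.coh_comp (𝟙 X) (𝟙 X) f g

theorem coh_comp_id (X : M) {Y Y' Y'' : M} (f : Y ⟶ Y') (g : Y' ⟶ Y'') :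
    D.coh (f ≫ g) (𝟙 X) = D.coh f (𝟙 X) ≫ D.coh g (𝟙 X) := by
  simpa using D.coh_comp f g (𝟙 X) (𝟙 X)

theorem coh_exchange {X X' Y Y' : M} (f : X ⟶ X') (g : Y ⟶ Y') :
    D.coh f (𝟙 Y) ≫ D.coh (𝟙 X') g = D.coh (𝟙 X) g ≫ D.coh f (𝟙 Y') := by
  simp [← D.coh_comp]

theorem coh_assoc_hom {X₁ Y₁ X₂ Y₂ X₃ Y₃ : M} (f₁ : X₁ ⟶ Y₁) (f₂ : X₂ ⟶ Y₂) (f₃ : X₃ ⟶ Y₃) :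
    D.coh (D.coh f₁ f₂) f₃ ≫ eqToHom (D.coA Y₁ Y₂ Y₃)
      = eqToHom (D.coA X₁ X₂ X₃) ≫ D.coh f₁ (D.coh f₂ f₃) := by
  simp [D.coh_assoc]

theorem coh_assoc_inv {X₁ Y₁ X₂ Y₂ X₃ Y₃ : M} (f₁ : X₁ ⟶ Y₁) (f₂ : X₂ ⟶ Y₂) (f₃ : X₃ ⟶ Y₃) :
    D.coh f₁ (D.coh f₂ f₃) ≫ eqToHom (D.coA Y₁ Y₂ Y₃).symm
      = eqToHom (D.coA X₁ X₂ X₃).symm ≫ D.coh (D.coh f₁ f₂) f₃ := by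
  simp [D.coh_assoc]

theorem coh_unitL_inv {X Y : M} (f : X ⟶ Y) :
    f ≫ eqToHom (D.coL Y).symm = eqToHom (D.coL X).symm ≫ D.coh (𝟙 D.uI) f := by
  simp [D.coh_unitL]

theorem coh_unitR_inv {X Y : M} (f : X ⟶ Y) :
    f ≫ eqToHom (D.coR Y).symm = eqToHom (D.coR X).symm ≫ D.coh f (𝟙 D.uI) := by
  simp [D.coh_unitR]

theorem buh_unitR_hom {X Y : M} (f : X ⟶ Y) :
    eqToHom (D.buR X) ≫ f = D.buh f (𝟙 D.uJ) ≫ eqToHom (D.buR Y) := by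
  simp [D.buh_unitR]

theorem coh_eqToHom_left {X X' Y Y' : M} (h : X = X') (f : Y ⟶ Y') :
    D.coh (𝟙 X) f ≫ eqToHom (show D.co X Y' = D.co X' Y' by rw [h])
      = eqToHom (show D.co X Y = D.co X' Y by rw [h]) ≫ D.coh (𝟙 X') f := by
  subst h; simp

theorem coh_buh_unitL {X X' : M} (Y : M) (f : X ⟶ X') :
    D.coh f (𝟙 Y) ≫ eqToHom (show D.co X' Y = D.co (D.bu D.uJ X') Y by rw [D.buL])
      = eqToHom (show D.co X Y = D.co (D.bu D.uJ X) Y by rw [D.buL])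
        ≫ D.coh (D.buh (𝟙 D.uJ) f) (𝟙 Y) := by
  rw [D.buh_unitL]
  simp [D.coh_comp_id, D.coh_eqToHom_id]

theorem zt_pw_left (X Y : M) :
    D.zt D.uJ X D.uJ Y ≫ D.buh D.pw (𝟙 (D.co X Y)) = eqToHom (by simp [D.buL]) := by
  have h := D.zt_unitC X Y
  rw [← cancel_epi (eqToHom (show D.co X Y = D.co (D.bu D.uJ X) (D.bu D.uJ Y) by simp [D.buL])),
    ← cancel_mono (eqToHom (D.buL (D.co X Y)))]
  simpa using h

theorem eqToHom_buR_eq_zt_pw (X Y : M) :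
    D.coh (𝟙 X) (eqToHom (D.buR Y))
      = eqToHom (show D.co X (D.bu Y D.uJ) = D.co (D.bu X D.uJ) (D.bu Y D.uJ) by rw [D.buR X])
        ≫ D.zt X D.uJ Y D.uJ ≫ D.buh (𝟙 (D.co X Y)) D.pw ≫ eqToHom (D.buR (D.co X Y)) := by
  have h := D.zt_unitD X Y
  rw [← cancel_epi (eqToHom (show D.co X Y = D.co X (D.bu Y D.uJ) by rw [D.buR]))]
  simpa [D.coh_id_eqToHom] using h.symm

end Duo

namespace RWB

variable {M : Type u} [Category.{v} M] {D : Duo M} (W : RWB D)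

/-- The morphism `((J∘A)•g).ζ.(X∘(Δ.η)) : X ⟶ J∘A` attached to `g : X∘A ⟶ J`, where `X` is read
as `J•X`. -/
def capOf (X : M) (g : D.co X W.A ⟶ D.uJ) : X ⟶ D.co D.uJ W.A :=
  eqToHom (D.coR X).symm
    ≫ D.coh (𝟙 X) (W.eta ≫ W.dl)
    ≫ eqToHom (show D.co X (D.bu W.A W.A) = D.co (D.bu D.uJ X) (D.bu W.A W.A) by rw [D.buL])
    ≫ D.zt D.uJ X W.A W.A
    ≫ D.buh (𝟙 (D.co D.uJ W.A)) g
    ≫ eqToHom (D.buR (D.co D.uJ W.A))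

/-- The pairing `ϖ.(J∘(ε.μ)) : J∘A∘A ⟶ J`. -/
def pairing : D.co (D.co D.uJ W.A) W.A ⟶ D.uJ :=
  eqToHom (D.coA D.uJ W.A W.A) ≫ D.coh (𝟙 D.uJ) (W.mu ≫ W.ep) ≫ D.pw

/-- The right `A`-action `J∘μ` on `J∘A`. -/
def actA : D.co (D.co D.uJ W.A) W.A ⟶ D.co D.uJ W.A :=
  eqToHom (D.coA D.uJ W.A W.A) ≫ D.coh (𝟙 D.uJ) W.mu

/-- The left `J`-action `ϖ∘A` on `J∘A`. -/
def actJ : D.co D.uJ (D.co D.uJ W.A) ⟶ D.co D.uJ W.A :=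
  eqToHom (D.coA D.uJ D.uJ W.A).symm ≫ D.coh D.pw (𝟙 W.A)

/-- `⊓^R_∘` as an endomorphism of the unfolded object `J∘A`. -/
def cap : D.co D.uJ W.A ⟶ D.co D.uJ W.A := W.sqcapR

theorem cap_eq_capOf : W.cap = W.capOf (D.co D.uJ W.A) W.pairing := by
  have h : ∀ {X Y : M} (f : X ⟶ Y) (g : Y ⟶ D.uJ) (Z : M),
      D.buh (𝟙 Z) (f ≫ g) = D.buh (𝟙 Z) f ≫ D.buh (𝟙 Z) g := fun f g Z => by
    simpa using D.buh_comp (𝟙 Z) (𝟙 Z) f g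
  simp only [cap, sqcapR, capOf, pairing, JA]
  rw [← Category.assoc (eqToHom _) (D.coh _ _) D.pw, h]
  simp only [Category.assoc]

theorem comp_capOf {X Y : M} (f : X ⟶ Y) (g : D.co Y W.A ⟶ D.uJ) :
    f ≫ W.capOf Y g = W.capOf X (D.coh f (𝟙 W.A) ≫ g) := by
  have hz := D.zt_nat (𝟙 D.uJ) f (𝟙 W.A) (𝟙 W.A)
  have hb : D.buh (𝟙 (D.co D.uJ W.A)) (D.coh f (𝟙 W.A) ≫ g)
      = D.buh (𝟙 _) (D.coh f (𝟙 W.A)) ≫ D.buh (𝟙 _) g := by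
    simpa using D.buh_comp (𝟙 _) (𝟙 _) (D.coh f (𝟙 W.A)) g
  rw [D.buh_id, D.coh_id] at hz
  simp only [capOf]
  rw [hb, reassoc_of% (D.coh_unitR_inv f), reassoc_of% (D.coh_exchange f (W.eta ≫ W.dl)),
    reassoc_of% (D.coh_buh_unitL (D.bu W.A W.A) f), reassoc_of% hz]
  simp only [Category.assoc]

theorem zt_buh_actJ {X : M} (g : D.co X W.A ⟶ D.uJ) :
    D.coh (𝟙 D.uJ) (D.zt D.uJ X W.A W.A ≫ D.buh (𝟙 (D.co D.uJ W.A)) g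
        ≫ eqToHom (D.buR (D.co D.uJ W.A))) ≫ W.actJ
      = eqToHom (show D.co D.uJ (D.co (D.bu D.uJ X) (D.bu W.A W.A))
            = D.co (D.bu D.uJ (D.co D.uJ X)) (D.bu W.A W.A) by simp [D.buL, D.coA])
        ≫ D.zt D.uJ (D.co D.uJ X) W.A W.A
        ≫ D.buh (𝟙 (D.co D.uJ W.A))
          (eqToHom (D.coA D.uJ X W.A) ≫ D.coh (𝟙 D.uJ) g ≫ D.pw)
        ≫ eqToHom (D.buR (D.co D.uJ W.A)) := by
  have hz := D.zt_nat (𝟙 D.uJ) (𝟙 D.uJ) (𝟙 (D.co D.uJ W.A)) g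
  rw [D.buh_id, D.coh_id] at hz
  have ha := D.zt_assoc1 D.uJ D.uJ D.uJ X W.A W.A
  have hn := D.zt_nat D.pw (𝟙 (D.co D.uJ X)) (𝟙 W.A) (𝟙 W.A)
  rw [D.buh_id, D.coh_id] at hn
  replace hn := congrArg (D.coh (D.zt D.uJ D.uJ D.uJ X) (𝟙 (D.bu W.A W.A)) ≫ ·) hn
  rw [← Category.assoc, ← D.coh_comp_id, D.zt_pw_left, D.coh_eqToHom_id, reassoc_of% ha] at hn
  have ha' : D.coh (𝟙 (D.bu D.uJ D.uJ)) (D.zt D.uJ X W.A W.A)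
        ≫ D.zt D.uJ D.uJ (D.co D.uJ W.A) (D.co X W.A)
        ≫ D.buh (eqToHom (D.coA D.uJ D.uJ W.A).symm ≫ D.coh D.pw (𝟙 W.A))
          (eqToHom (D.coA D.uJ X W.A).symm)
      = eqToHom (show D.co (D.bu D.uJ D.uJ) (D.co (D.bu D.uJ X) (D.bu W.A W.A))
            = D.co (D.bu D.uJ (D.co D.uJ X)) (D.bu W.A W.A) by simp [D.buL, D.coA])
        ≫ D.zt D.uJ (D.co D.uJ X) W.A W.A := by
    rw [← cancel_epi (eqToHom (D.coA (D.bu D.uJ D.uJ) (D.bu D.uJ X) (D.bu W.A W.A)))]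
    have hb := D.buh_comp (eqToHom (D.coA D.uJ D.uJ W.A).symm) (D.coh D.pw (𝟙 W.A))
      (eqToHom (D.coA D.uJ X W.A).symm) (𝟙 _)
    rw [Category.comp_id] at hb
    rw [hb, D.buh_eqToHom, ← hn]
    simp
  have hL : D.coh (𝟙 D.uJ) (D.zt D.uJ X W.A W.A)
      ≫ eqToHom (show D.co D.uJ (D.bu (D.co D.uJ W.A) (D.co X W.A))
        = D.co (D.bu D.uJ D.uJ) (D.bu (D.co D.uJ W.A) (D.co X W.A)) by rw [D.buR])
      = eqToHom (by rw [D.buR]) ≫ D.coh (𝟙 (D.bu D.uJ D.uJ)) (D.zt D.uJ X W.A W.A) :=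
    D.coh_eqToHom_left (D.buR D.uJ).symm _
  have hG := D.coh_eqToHom_left (D.buR D.uJ).symm (D.buh (𝟙 (D.co D.uJ W.A)) g)
  have hB : D.buh (𝟙 (D.co D.uJ (D.co D.uJ W.A))) (D.coh (𝟙 D.uJ) g)
      ≫ D.buh (𝟙 _) D.pw ≫ D.buh W.actJ (𝟙 D.uJ)
      = D.buh (eqToHom (D.coA D.uJ D.uJ W.A).symm ≫ D.coh D.pw (𝟙 W.A))
          (eqToHom (D.coA D.uJ X W.A).symm)
        ≫ D.buh (𝟙 _) (eqToHom (D.coA D.uJ X W.A) ≫ D.coh (𝟙 D.uJ) g ≫ D.pw) := by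
    simp [← D.buh_comp, actJ]
  rw [D.coh_id_comp, D.coh_id_comp, D.eqToHom_buR_eq_zt_pw]
  simp only [Category.assoc]
  rw [D.buh_unitR_hom, reassoc_of% hG, reassoc_of% hL, reassoc_of% hz, reassoc_of% hB,
    reassoc_of% ha']
  simp

theorem capOf_actJ {X : M} (g : D.co X W.A ⟶ D.uJ) :
    D.coh (𝟙 D.uJ) (W.capOf X g) ≫ W.actJ
      = W.capOf (D.co D.uJ X) (eqToHom (D.coA D.uJ X W.A) ≫ D.coh (𝟙 D.uJ) g ≫ D.pw) := by
  have h := D.coh_assoc_hom (𝟙 D.uJ) (𝟙 X) (W.eta ≫ W.dl)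
  rw [D.coh_id] at h
  have h' : D.coh (𝟙 D.uJ) (D.coh (𝟙 X) (W.eta ≫ W.dl))
      = eqToHom (D.coA D.uJ X D.uI).symm ≫ D.coh (𝟙 (D.co D.uJ X)) (W.eta ≫ W.dl)
        ≫ eqToHom (D.coA D.uJ X (D.bu W.A W.A)) := by
    simp [h]
  simp only [capOf, D.coh_id_comp _ (eqToHom (D.coR X).symm),
    D.coh_id_comp _ (D.coh (𝟙 X) _), D.coh_id_comp _ (eqToHom (show D.co X (D.bu W.A W.A)
      = D.co (D.bu D.uJ X) (D.bu W.A W.A) by rw [D.buL])), Category.assoc]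
  rw [zt_buh_actJ, h', D.coh_id_eqToHom, D.coh_id_eqToHom]
  simp

theorem coh_actJ_pairing :
    D.coh W.actJ (𝟙 W.A) ≫ W.pairing
      = eqToHom (D.coA D.uJ (D.co D.uJ W.A) W.A) ≫ D.coh (𝟙 D.uJ) W.pairing ≫ D.pw := by
  have h1 := D.coh_assoc_hom D.pw (𝟙 W.A) (𝟙 W.A)
  have h2 := D.coh_exchange D.pw (W.mu ≫ W.ep)
  have h3 := D.coh_assoc_hom (𝟙 D.uJ) (𝟙 D.uJ) (W.mu ≫ W.ep)
  rw [D.coh_id] at h1 h3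
  simp only [actJ, pairing, D.coh_comp_id, D.coh_id_comp, D.coh_eqToHom_id, D.coh_id_eqToHom,
    Category.assoc]
  simp only [D.coh_id_comp, Category.assoc] at h2 h3
  rw [reassoc_of% h1, reassoc_of% h2, D.pw_assoc, reassoc_of% h3]
  simp

/-- `⊓^R_∘` is left `J`-linear. -/
theorem cap_actJ : D.coh (𝟙 D.uJ) W.cap ≫ W.actJ = W.actJ ≫ W.cap := by
  rw [cap_eq_capOf, capOf_actJ, comp_capOf, coh_actJ_pairing]

theorem actA_assoc :
    D.coh W.actA (𝟙 W.A) ≫ W.actA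
      = eqToHom (D.coA (D.co D.uJ W.A) W.A W.A) ≫ D.coh (𝟙 _) W.mu ≫ W.actA := by
  have h1 := D.coh_assoc_hom (𝟙 D.uJ) W.mu (𝟙 W.A)
  have h2 := D.coh_assoc_hom (𝟙 D.uJ) (𝟙 W.A) W.mu
  have h3 := congrArg (D.coh (𝟙 D.uJ)) W.mu_assoc
  rw [D.coh_id] at h2
  simp only [D.coh_id_comp, D.coh_id_eqToHom] at h3
  simp only [actA, D.coh_comp_id, D.coh_eqToHom_id, Category.assoc]
  rw [reassoc_of% h1, h3, reassoc_of% h2]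
  simp

theorem actA_unit :
    eqToHom (D.coR (D.co D.uJ W.A)).symm ≫ D.coh (𝟙 _) W.eta ≫ W.actA = 𝟙 _ := by
  have h1 := D.coh_assoc_hom (𝟙 D.uJ) (𝟙 W.A) W.eta
  have h2 := congrArg (D.coh (𝟙 D.uJ)) W.mu_unitR
  simp only [D.coh_id_comp, D.coh_id_eqToHom, D.coh_id] at h1 h2
  simp only [actA]
  rw [reassoc_of% h1]
  simpa using h2

theorem coh_actA_pairing :
    D.coh W.actA (𝟙 W.A) ≫ W.pairing
      = eqToHom (D.coA (D.co D.uJ W.A) W.A W.A) ≫ D.coh (𝟙 _) W.mu ≫ W.pairing := by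
  have h : W.pairing = W.actA ≫ D.coh (𝟙 D.uJ) W.ep ≫ D.pw := by
    simp [pairing, actA, D.coh_id_comp]
  rw [h, reassoc_of% W.actA_assoc]

/-- The morphism `((J∘A)•ϖ).((J∘A)•(J∘(ε.μ))).ζ.(J∘A∘Δ) : J∘A∘A ⟶ J∘A`, whose composite with
`J∘A∘η` is `⊓^R_∘`. -/
def coactA : D.co (D.co D.uJ W.A) W.A ⟶ D.co D.uJ W.A :=
  D.coh (𝟙 _) W.dl
    ≫ eqToHom (show D.co (D.co D.uJ W.A) (D.bu W.A W.A)
        = D.co (D.bu D.uJ (D.co D.uJ W.A)) (D.bu W.A W.A) by rw [D.buL])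
    ≫ D.zt D.uJ (D.co D.uJ W.A) W.A W.A
    ≫ D.buh (𝟙 _) W.pairing
    ≫ eqToHom (D.buR _)

theorem coh_coactA_pairing :
    D.coh W.coactA (𝟙 W.A) ≫ W.pairing = D.coh W.actA (𝟙 W.A) ≫ W.pairing := by
  have h := W.llc
  have hb : D.buh (𝟙 (D.co D.uJ W.A)) W.pairing
      = D.buh (𝟙 _) (eqToHom (D.coA D.uJ W.A W.A) ≫ D.coh (𝟙 D.uJ) (W.mu ≫ W.ep))
        ≫ D.buh (𝟙 _) D.pw := by
    simp [← D.buh_comp, pairing]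
  rw [coh_actA_pairing]
  simp only [coactA, hb]
  simp only [D.coh_comp_id, D.coh_eqToHom_id, pairing, Category.assoc]
  rw [eqToHom_trans_assoc]
  refine h.trans ?_
  simp [D.coh_id_comp]

theorem cap_pairing : D.coh W.cap (𝟙 W.A) ≫ W.pairing = W.pairing := by
  have h := congrArg (fun f => D.coh (eqToHom (D.coR (D.co D.uJ W.A)).symm
    ≫ D.coh (𝟙 _) W.eta) (𝟙 W.A) ≫ f) W.coh_coactA_pairing
  simp only [← Category.assoc, ← D.coh_comp_id] at h
  have h1 : (eqToHom (D.coR (D.co D.uJ W.A)).symm ≫ D.coh (𝟙 _) W.eta) ≫ W.actA = 𝟙 _ := by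
    rw [Category.assoc, actA_unit]
  have h2 : (eqToHom (D.coR (D.co D.uJ W.A)).symm ≫ D.coh (𝟙 _) W.eta) ≫ W.coactA = W.cap := by
    rw [cap_eq_capOf]
    simp [capOf, coactA, D.coh_id_comp]
  rw [h1, h2, D.coh_id, Category.id_comp] at h
  exact h

theorem actJ_assoc :
    D.coh D.pw (𝟙 (D.co D.uJ W.A)) ≫ W.actJ
      = eqToHom (D.coA D.uJ D.uJ _) ≫ D.coh (𝟙 D.uJ) W.actJ ≫ W.actJ := by
  have h1 := D.coh_assoc_inv D.pw (𝟙 D.uJ) (𝟙 W.A)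
  have h2 := D.coh_assoc_inv (𝟙 D.uJ) D.pw (𝟙 W.A)
  have h3 := congrArg (fun f => D.coh f (𝟙 W.A)) D.pw_assoc
  simp only [D.coh_comp_id, D.coh_eqToHom_id, D.coh_id] at h1 h3
  simp only [actJ, D.coh_id_comp, D.coh_id_eqToHom, Category.assoc]
  rw [reassoc_of% h1, h3, reassoc_of% h2]
  simp

theorem actJ_unit :
    eqToHom (D.coL (D.co D.uJ W.A)).symm ≫ D.coh D.tau (𝟙 _) ≫ W.actJ = 𝟙 _ := by
  have h1 := D.coh_assoc_inv D.tau (𝟙 D.uJ) (𝟙 W.A)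
  have h2 := congrArg (fun f => D.coh f (𝟙 W.A)) D.pw_unitL
  simp only [D.coh_comp_id, D.coh_eqToHom_id, D.coh_id] at h1 h2
  simp only [actJ]
  rw [reassoc_of% h1]
  simpa using h2

theorem actJ_actA :
    D.coh W.actJ (𝟙 W.A) ≫ W.actA
      = eqToHom (D.coA D.uJ _ W.A) ≫ D.coh (𝟙 D.uJ) W.actA ≫ W.actJ := by
  have h1 := D.coh_assoc_hom D.pw (𝟙 W.A) (𝟙 W.A)
  have h2 := D.coh_exchange D.pw W.mu
  have h3 := D.coh_assoc_inv (𝟙 D.uJ) (𝟙 D.uJ) W.mu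
  rw [D.coh_id] at h1 h3
  simp only [actJ, actA, D.coh_comp_id, D.coh_id_comp, D.coh_eqToHom_id, D.coh_id_eqToHom,
    Category.assoc]
  rw [reassoc_of% h1, h2, reassoc_of% h3]
  simp

/-- `⊓^R_∘.(J∘μ)` absorbs `⊓^R_∘` in its first argument. -/
theorem coh_cap_actA_cap :
    D.coh W.cap (𝟙 W.A) ≫ W.actA ≫ W.cap = W.actA ≫ W.cap := by
  have h1 := D.coh_assoc_hom W.cap (𝟙 W.A) (𝟙 W.A)
  have h2 := D.coh_exchange W.cap W.mu
  rw [D.coh_id] at h1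
  have h3 : W.actA ≫ W.cap = W.capOf _ (eqToHom (D.coA (D.co D.uJ W.A) W.A W.A)
      ≫ D.coh (𝟙 _) W.mu ≫ W.pairing) := by
    rw [cap_eq_capOf, comp_capOf, coh_actA_pairing]
  rw [h3, comp_capOf, reassoc_of% h1, reassoc_of% h2, cap_pairing]

theorem isBimodule_of_retract {R : M} (p : D.co D.uJ W.A ⟶ R) (i : R ⟶ D.co D.uJ W.A)
    (hpi : p ≫ i = W.cap) (hip : i ≫ p = 𝟙 R) :
    (eqToHom (D.coL R).symm ≫ D.coh D.tau (𝟙 R) ≫ W.gamJ R p i = 𝟙 R) ∧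
    (eqToHom (D.coR R).symm ≫ D.coh (𝟙 R) W.eta ≫ W.gamA R p i = 𝟙 R) ∧
    (D.coh D.pw (𝟙 R) ≫ W.gamJ R p i
      = eqToHom (D.coA D.uJ D.uJ R) ≫ D.coh (𝟙 D.uJ) (W.gamJ R p i) ≫ W.gamJ R p i) ∧
    (D.coh (W.gamA R p i) (𝟙 W.A) ≫ W.gamA R p i
      = eqToHom (D.coA R W.A W.A) ≫ D.coh (𝟙 R) W.mu ≫ W.gamA R p i) ∧
    (D.coh (W.gamJ R p i) (𝟙 W.A) ≫ W.gamA R p i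
      = eqToHom (D.coA D.uJ R W.A) ≫ D.coh (𝟙 D.uJ) (W.gamA R p i) ≫ W.gamJ R p i) := by
  have hcp : W.cap ≫ p = p := by rw [← hpi, Category.assoc, hip, Category.comp_id]
  have hA : W.gamA R p i = D.coh i (𝟙 W.A) ≫ W.actA ≫ p := by
    simp only [gamA, actA, Category.assoc]; rfl
  have hJ : W.gamJ R p i = D.coh (𝟙 D.uJ) i ≫ W.actJ ≫ p := by
    simp only [gamJ, actJ, Category.assoc]; rfl
  have hcA : D.coh W.cap (𝟙 W.A) ≫ W.actA ≫ p = W.actA ≫ p := by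
    rw [← hcp, reassoc_of% W.coh_cap_actA_cap]
  have hcJ : D.coh (𝟙 D.uJ) W.cap ≫ W.actJ ≫ p = W.actJ ≫ p := by
    rw [reassoc_of% W.cap_actJ, hcp]
  have hpA : D.coh p (𝟙 W.A) ≫ W.gamA R p i = W.actA ≫ p := by
    rw [hA, ← Category.assoc, ← D.coh_comp_id, hpi, hcA]
  have hpJ : D.coh (𝟙 D.uJ) p ≫ W.gamJ R p i = W.actJ ≫ p := by
    rw [hJ, ← Category.assoc, ← D.coh_id_comp, hpi, hcJ]
  refine ⟨?_, ?_, ?_, ?_, ?_⟩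
  · rw [hJ, reassoc_of% (D.coh_exchange D.tau i), ← reassoc_of% (D.coh_unitL_inv i),
      reassoc_of% W.actJ_unit, hip]
  · rw [hA, ← reassoc_of% (D.coh_exchange i W.eta), ← reassoc_of% (D.coh_unitR_inv i),
      reassoc_of% W.actA_unit, hip]
  · have h := D.coh_assoc_hom (𝟙 D.uJ) (𝟙 D.uJ) i
    rw [D.coh_id] at h
    conv_rhs => rw [hJ, D.coh_id_comp, D.coh_id_comp, ← hJ, Category.assoc, Category.assoc, hpJ]
    rw [hJ, reassoc_of% (D.coh_exchange D.pw i), reassoc_of% W.actJ_assoc, reassoc_of% h]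
  · have h := D.coh_assoc_hom i (𝟙 W.A) (𝟙 W.A)
    rw [D.coh_id] at h
    conv_lhs => rw [hA, D.coh_comp_id, D.coh_comp_id, ← hA, Category.assoc, Category.assoc, hpA]
    rw [hA, reassoc_of% W.actA_assoc, reassoc_of% h, ← reassoc_of% (D.coh_exchange i W.mu)]
  · have h := D.coh_assoc_hom (𝟙 D.uJ) i (𝟙 W.A)
    conv_lhs => rw [hJ, D.coh_comp_id, D.coh_comp_id, Category.assoc, Category.assoc, hpA]
    conv_rhs => rw [hA, D.coh_id_comp, D.coh_id_comp, Category.assoc, Category.assoc, hpJ]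
    rw [reassoc_of% W.actJ_actA, reassoc_of% h]

end RWB

/-- **Statement 8.**  For a right weak bimonoid `A` in a duoidal category with split
idempotents and a fixed splitting of `⊓^R_∘` through `R_∘`, the object `R_∘` is a
`J`-`A` bimodule in `(M,∘)`: the left `J`-action `γ_J` and the right `A`-action
`γ_A` are unital and associative and they commute with each other. -/
theorem R_is_J_A_bimodule
    {M : Type u} [Category.{v} M] (D : Duo M) (W : RWB D)
    (hsplit : SplitIdem M)
    (R : M) (p : W.JA ⟶ R) (i : R ⟶ W.JA)
    (hpi : p ≫ i = W.sqcapR) (hip : i ≫ p = 𝟙 R) :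
    -- unitality:  γ_J.(τ∘R_∘) = id  and  γ_A.(R_∘∘η) = id
    (eqToHom (D.coL R).symm ≫ D.coh D.tau (𝟙 R) ≫ W.gamJ R p i = 𝟙 R) ∧
    (eqToHom (D.coR R).symm ≫ D.coh (𝟙 R) W.eta ≫ W.gamA R p i = 𝟙 R) ∧
    -- associativity:  γ_J.(ϖ∘R_∘) = γ_J.(J∘γ_J)  and  γ_A.(γ_A∘A) = γ_A.(R_∘∘μ)
    (D.coh D.pw (𝟙 R) ≫ W.gamJ R p i
      = eqToHom (D.coA D.uJ D.uJ R) ≫ D.coh (𝟙 D.uJ) (W.gamJ R p i) ≫ W.gamJ R p i) ∧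
    (D.coh (W.gamA R p i) (𝟙 W.A) ≫ W.gamA R p i
      = eqToHom (D.coA R W.A W.A) ≫ D.coh (𝟙 R) W.mu ≫ W.gamA R p i) ∧
    -- the two actions commute:  γ_A.(γ_J∘A) = γ_J.(J∘γ_A)
    (D.coh (W.gamJ R p i) (𝟙 W.A) ≫ W.gamA R p i
      = eqToHom (D.coA D.uJ R W.A) ≫ D.coh (𝟙 D.uJ) (W.gamA R p i) ≫ W.gamJ R p i) := by
  exact W.isBimodule_of_retract p i hpi hip
end
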